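/- arXiv:1903.03573 — 5 statements merged into one kernel-verified Lean document; each statement's English description precedes it below -/
import Mathlib

section
/- Let H be an r-uniform, complete r-partite hypergraph (with each part nonempty) and let J = I(H) be its edge ideal in a polynomial ring over a field. Then the n-th symbolic power of J equals its ordinary power, J^(n) = J^n, for all n ≥ 1. -/
open MvPolynomial

/-- The `n`-th symbolic power of an ideal: the intersection of the `n`-th powers of the
minimal primes of `I`. -/
def symbolicPower {R : Type*} [CommRing R] (I : Ideal R) (n : ℕ) : Ideal R :=
  ⨅ p ∈ I.minimalPrimes, p ^ n

/-- The edge ideal of a hypergraph with hyperedge set `H` on a finite vertex set `V`,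
in the polynomial ring `k[x_v : v ∈ V]`. -/
noncomputable def edgeIdeal (k : Type*) [Field k] {V : Type*}
    (H : Set (Finset V)) : Ideal (MvPolynomial V k) :=
  Ideal.span ((fun E : Finset V => ∏ v ∈ E, X v) '' H)

theorem rp_prime (k : Type*) [Field k] {V : Type*} (s : Set V) :
    (Ideal.span (X '' s : Set (MvPolynomial V k))).IsPrime := by
  classical
  let φ : MvPolynomial V k →ₐ[k] MvPolynomial V k := aeval (fun v => if v ∈ s then 0 else X v)
  have h : Ideal.span (X '' s : Set (MvPolynomial V k)) = RingHom.ker φ := by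
    apply le_antisymm
    · rw [Ideal.span_le]
      rintro _ ⟨v, hv, rfl⟩
      simp [φ, RingHom.mem_ker, hv]
    · intro f hf
      have e : (Ideal.Quotient.mkₐ k (Ideal.span (X '' s : Set (MvPolynomial V k)))).comp φ
          = Ideal.Quotient.mkₐ k _ := by
        apply MvPolynomial.algHom_ext
        intro v
        by_cases hv : v ∈ s
        · simp only [AlgHom.comp_apply, φ, aeval_X, hv, if_true, map_zero]
          symm
          rw [Ideal.Quotient.mkₐ_eq_mk, Ideal.Quotient.eq_zero_iff_mem]
          exact Ideal.subset_span ⟨v, hv, rfl⟩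
        · simp [φ, hv]
      have e2 := DFunLike.congr_fun e f
      rw [AlgHom.comp_apply, (RingHom.mem_ker).1 hf, map_zero, Ideal.Quotient.mkₐ_eq_mk] at e2
      exact Ideal.Quotient.eq_zero_iff_mem.1 e2.symm
  rw [h]
  exact RingHom.ker_isPrime _

/-- polynomials all of whose monomials have degree at least `n` in the variables of `s`. -/
def rp_deg (k : Type*) [Field k] {V : Type*} (s : Finset V) (n : ℕ) :
    Ideal (MvPolynomial V k) where
  carrier := {f | ∀ m ∈ f.support, n ≤ ∑ v ∈ s, m v}
  zero_mem' := by simp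
  add_mem' := by
    classical
    intro a b ha hb m hm
    rcases Finset.mem_union.1 (support_add hm) with h | h
    · exact ha m h
    · exact hb m h
  smul_mem' := by
    classical
    intro c a ha m hm
    rw [smul_eq_mul] at hm
    obtain ⟨p, hp, q, hq, rfl⟩ := Finset.mem_add.1 (support_mul c a hm)
    have := ha q hq
    simp only [Finsupp.add_apply, Finset.sum_add_distrib]
    omega

theorem rp_pow_le (k : Type*) [Field k] {V : Type*} (s : Finset V) (n : ℕ) :
    (Ideal.span (X '' (s : Set V) : Set (MvPolynomial V k))) ^ n ≤ rp_deg k s n := by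
  classical
  induction n with
  | zero => intro f _ m _; exact Nat.zero_le _
  | succ n ih =>
    rw [pow_succ, Ideal.mul_le]
    intro f hf g hg m hm
    obtain ⟨p, hp, q, hq, rfl⟩ := Finset.mem_add.1 (support_mul f g hm)
    have h1 := ih hf p hp
    obtain ⟨v, hv, hvq⟩ := mem_ideal_span_X_image.1 hg q hq
    have h2 : q v ≤ ∑ v ∈ s, q v := Finset.single_le_sum (fun _ _ => Nat.zero_le _) hv
    simp only [Finsupp.add_apply, Finset.sum_add_distrib]
    omega

theorem rp_prod_mem (k : Type*) [Field k] {V : Type*} (s : Finset V) (n : ℕ) (m : V →₀ ℕ)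
    (h : n ≤ ∑ v ∈ s, m v) :
    ∏ v ∈ s, (X v : MvPolynomial V k) ^ m v ∈
      (Ideal.span (X '' (s : Set V) : Set (MvPolynomial V k))) ^ n := by
  apply Ideal.pow_le_pow_right h
  rw [← Finset.prod_pow_eq_pow_sum]
  exact Ideal.prod_mem_prod fun v hv =>
    Ideal.pow_mem_pow (Ideal.subset_span (Set.mem_image_of_mem X (Finset.mem_coe.2 hv))) _

/-- If `H` is an `r`-uniform complete `r`-partite hypergraph (with each
part nonempty), then the symbolic and ordinary powers of its edge ideal coincide:
`J⁽ⁿ⁾ = Jⁿ` for all `n ≥ 1`. -/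
theorem symbolicPower_eq_pow_of_complete_r_partite
    (k : Type*) [Field k] {V : Type*} [Fintype V] [DecidableEq V]
    (r : ℕ) (H : Set (Finset V)) (X : Fin r → Finset V)
    -- the parts are pairwise disjoint and cover the vertex set
    (hdisj : ∀ i j : Fin r, i ≠ j → Disjoint (X i) (X j))
    (hcover : ∀ v : V, ∃ i : Fin r, v ∈ X i)
    -- each part is nonempty
    (hne : ∀ i : Fin r, (X i).Nonempty)
    -- `H` is `r`-uniform
    (huniform : ∀ E ∈ H, E.card = r)
    -- `H` is `r`-partite with respect to the partition `X`
    (hpartite : ∀ E ∈ H, ∀ i : Fin r, (E ∩ X i).card = 1)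
    -- `H` is complete `r`-partite
    (hcomplete : ∀ c : Fin r → V, (∀ i, c i ∈ X i) →
      Finset.image c Finset.univ ∈ H) :
    ∀ n : ℕ, 1 ≤ n →
      symbolicPower (edgeIdeal k H) n = (edgeIdeal k H) ^ n := by
  intro n _
  classical
  set P : Fin r → Ideal (MvPolynomial V k) :=
    fun i => Ideal.span (MvPolynomial.X '' (X i : Set V)) with hP
  have hinj : ∀ c : Fin r → V, (∀ i, c i ∈ X i) → Function.Injective c := by
    intro c hc i j hij
    by_contra hne'
    exact Finset.disjoint_left.1 (hdisj i j hne') (hc i) (hij ▸ hc j)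
  have hJP : ∀ i, edgeIdeal k H ≤ P i := by
    intro i
    rw [edgeIdeal, Ideal.span_le]
    rintro _ ⟨E, hE, rfl⟩
    obtain ⟨v, hv⟩ := Finset.card_pos.1 (by rw [hpartite E hE i]; exact one_pos)
    rw [Finset.mem_inter] at hv
    exact Ideal.mem_of_dvd _ (Finset.dvd_prod_of_mem _ hv.1)
      (Ideal.subset_span ⟨v, hv.2, rfl⟩)
  have hPJ : ∏ i, P i ≤ edgeIdeal k H := by
    rw [hP, Ideal.prod_span, Ideal.span_le]
    intro f hf
    obtain ⟨g, hg, rfl⟩ := (Set.mem_fintype_prod _ _).1 hf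
    choose c hc hcg using hg
    refine Ideal.subset_span ⟨_, hcomplete c hc, ?_⟩
    simp only
    rw [Finset.prod_image (fun a _ b _ h => hinj c hc h)]
    exact Finset.prod_congr rfl fun i _ => hcg i
  have hmin : ∀ i, P i ∈ (edgeIdeal k H).minimalPrimes := by
    intro i
    refine ⟨⟨rp_prime k _, hJP i⟩, ?_⟩
    rintro q ⟨hq, hJq⟩ hqP
    obtain ⟨j, -, hj⟩ := (Ideal.IsPrime.prod_le hq).1 (hPJ.trans hJq)
    have hji : j = i := by
      by_contra hne'
      obtain ⟨v, hv⟩ := hne j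
      have h1 : (MvPolynomial.X v : MvPolynomial V k) ∈ P i :=
        hqP (hj (Ideal.subset_span ⟨v, hv, rfl⟩))
      obtain ⟨w, hw, hwv⟩ := mem_ideal_span_X_image.1 h1 (Finsupp.single v 1)
        (by simp [MvPolynomial.support_X])
      have : v = w := by
        by_contra h
        simp [Finsupp.single_apply, h] at hwv
      subst this
      exact Finset.disjoint_left.1 (hdisj j i hne') hv hw
    exact hji ▸ hj
  apply le_antisymm
  · refine le_trans ?_ (Ideal.pow_right_mono hPJ n)
    intro f hf
    simp only [symbolicPower, Ideal.mem_iInf] at hf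
    rw [f.as_sum]
    refine Ideal.sum_mem _ fun m hm => ?_
    have hdeg : ∀ i, n ≤ ∑ v ∈ X i, m v := fun i =>
      rp_pow_le k (X i) n (hf (P i) (hmin i)) m hm
    have huniv : (Finset.univ : Finset V) = Finset.univ.biUnion X := by
      ext v; simpa using hcover v
    rw [MvPolynomial.monomial_eq, Finsupp.prod_fintype _ _ (by simp)]
    apply Ideal.mul_mem_left
    rw [huniv, Finset.prod_biUnion (fun i _ j _ h => hdisj i j h), ← Finset.prod_pow]
    exact Ideal.prod_mem_prod fun i _ => rp_prod_mem k (X i) n m (hdeg i)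
  · rw [symbolicPower]
    exact le_iInf₂ fun p hp => Ideal.pow_right_mono hp.1.2 n
end

section
/- Let k ∈ {1, 2, 3}, let J = I_3(C_{3k}) be the cubic path ideal of the cycle C_{3k} in a polynomial ring over a field, and let x be any variable (vertex) of C_{3k}. Then (J : x)^(n) = (J : x)^n for all n ≥ 1. -/
open MvPolynomial SimpleGraph

/-- The cubic path ideal `I₃(G)` of a graph `G`: the ideal of `k[x_v : v ∈ V]` generated by
the monomials `x_u x_v x_w` over all paths `u–v–w` on three distinct vertices of `G`. -/
noncomputable def pathIdeal3 (k : Type*) [Field k] {V : Type*} (G : SimpleGraph V) :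
    Ideal (MvPolynomial V k) :=
  Ideal.span {m | ∃ u v w : V, G.Adj u v ∧ G.Adj v w ∧ u ≠ w ∧ m = X u * X v * X w}

section Aux

variable {K : Type*} [Field K] {σ : Type*}

lemma span_X_isPrime (C : Set σ) :
    (Ideal.span (X '' C) : Ideal (MvPolynomial σ K)).IsPrime := by
  classical
  set P : Ideal (MvPolynomial σ K) := Ideal.span (X '' C) with hP
  let φ : MvPolynomial σ K →ₐ[K] MvPolynomial σ K :=
    aeval (fun i => if i ∈ C then 0 else X i)
  have hker : RingHom.ker φ = P := by
    apply le_antisymm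
    · intro f hf
      have h2 : (Ideal.Quotient.mkₐ K P).comp φ = Ideal.Quotient.mkₐ K P := by
        apply MvPolynomial.algHom_ext
        intro i
        by_cases hi : i ∈ C
        · simp only [AlgHom.comp_apply, φ, aeval_X, hi, if_true, map_zero]
          symm
          rw [Ideal.Quotient.mkₐ_eq_mk, Ideal.Quotient.eq_zero_iff_mem]
          exact Ideal.subset_span ⟨i, hi, rfl⟩
        · simp [φ, hi]
      have h3 := DFunLike.congr_fun h2 f
      rw [AlgHom.comp_apply, (RingHom.mem_ker).1 hf, map_zero] at h3
      rw [Ideal.Quotient.mkₐ_eq_mk] at h3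
      exact Ideal.Quotient.eq_zero_iff_mem.1 h3.symm
    · rw [hP, Ideal.span_le]
      rintro _ ⟨i, hi, rfl⟩
      simp [φ, RingHom.mem_ker, hi]
  rw [← hker]
  exact RingHom.ker_isPrime φ

lemma pow_span_X_le (C : Finset σ) (n : ℕ) :
    (Ideal.span (X '' (C : Set σ)) : Ideal (MvPolynomial σ K)) ^ n ≤
      Ideal.span ((fun s => monomial s (1 : K)) '' {s : σ →₀ ℕ | n ≤ ∑ i ∈ C, s i}) := by
  classical
  induction n with
  | zero =>
    rw [pow_zero, Ideal.one_eq_top]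
    apply le_of_eq
    symm
    rw [Ideal.eq_top_iff_one]
    exact Ideal.subset_span ⟨0, by simp, by simp⟩
  | succ n ih =>
    rw [pow_succ]
    refine (Ideal.mul_mono_left ih).trans ?_
    rw [Ideal.span_mul_span', Ideal.span_le]
    rintro _ ⟨_, ⟨s, hs, rfl⟩, _, ⟨i, hi, rfl⟩, rfl⟩
    refine Ideal.subset_span ⟨s + Finsupp.single i 1, ?_, ?_⟩
    · have h1 : ∑ j ∈ C, (Finsupp.single i 1 : σ →₀ ℕ) j = 1 := by
        simp only [Finsupp.single_apply]
        rw [Finset.sum_ite_eq]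
        simpa using hi
      simp only [Set.mem_ofPred_eq, Finsupp.add_apply, Finset.sum_add_distrib, h1] at hs ⊢
      omega
    · simp [X, monomial_mul]

lemma cover_bound (J : Ideal (MvPolynomial σ K)) (x : σ) (C : Finset σ) (hx : x ∉ C)
    (hJ : J ≤ Ideal.span (X '' (C : Set σ))) (n : ℕ) (f : MvPolynomial σ K)
    (hf : f ∈ symbolicPower (J.colon (Ideal.span {(X x : MvPolynomial σ K)})) n)
    (m : σ →₀ ℕ) (hm : m ∈ f.support) : n ≤ ∑ i ∈ C, m i := by
  classical
  set P : Ideal (MvPolynomial σ K) := Ideal.span (X '' (C : Set σ)) with hP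
  have : P.IsPrime := span_X_isPrime _
  have hxP : (X x : MvPolynomial σ K) ∉ P := by
    rw [hP, mem_ideal_span_X_image]
    intro h
    obtain ⟨i, hi, h⟩ := h (Finsupp.single x 1) (by simp [X, support_monomial])
    rw [Finsupp.single_apply] at h
    split_ifs at h with h1
    · subst h1; exact hx hi
    · exact h rfl
  have hle : J.colon (Ideal.span {(X x : MvPolynomial σ K)}) ≤ P := by
    intro g hg
    rw [Ideal.mem_colon_span_singleton] at hg
    exact ((Ideal.IsPrime.mem_or_mem ‹_› (hJ hg))).resolve_right hxP
  obtain ⟨p, hp, hpP⟩ := Ideal.exists_minimalPrimes_le hle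
  have hfp : f ∈ p ^ n := by
    simp only [symbolicPower, Submodule.mem_iInf] at hf
    exact hf p hp
  have hfW := pow_span_X_le C n (Ideal.pow_right_mono hpP n hfp)
  rw [mem_ideal_span_monomial_image] at hfW
  obtain ⟨s, hs, hsm⟩ := hfW m hm
  exact le_trans hs (Finset.sum_le_sum fun i _ => hsm i)

lemma main_of_monomial (I : Ideal (MvPolynomial σ K)) (n : ℕ)
    (h : ∀ f ∈ symbolicPower I n, ∀ m ∈ f.support, monomial m (1 : K) ∈ I ^ n) :
    symbolicPower I n = I ^ n := by
  apply le_antisymm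
  · intro f hf
    rw [f.as_sum]
    refine Ideal.sum_mem _ fun m hm => ?_
    have : monomial m (coeff m f) = C (coeff m f) * monomial m (1 : K) := by
      rw [C_mul_monomial, mul_one]
    rw [this]
    exact Ideal.mul_mem_left _ _ (h f hf m hm)
  · refine le_iInf₂ fun p hp => Ideal.pow_right_mono hp.1.2 n

end Aux

section Cyc

variable {K : Type*} [Field K] {N : ℕ}

lemma pathIdeal_le (C : Finset (Fin (N + 2)))
    (hC : ∀ v, v ∈ C ∨ v + 1 ∈ C ∨ v + 2 ∈ C) :
    pathIdeal3 K (cycleGraph (N + 2)) ≤ Ideal.span (X '' (C : Set (Fin (N + 2)))) := by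
  rw [pathIdeal3, Ideal.span_le]
  rintro _ ⟨u, v, w, huv, hvw, huw, rfl⟩
  have key : u ∈ C ∨ v ∈ C ∨ w ∈ C := by
    rw [cycleGraph_adj] at huv hvw
    have h2 : (2 : Fin (N + 2)) = 1 + 1 := Fin.ext (Nat.add_mod 1 1 _)
    rcases huv with huv | huv <;> rcases hvw with hvw | hvw
    · have e1 : v = w + 1 := by rw [← hvw]; abel
      have e2 : u = w + 2 := by rw [h2, ← add_assoc, ← e1, ← huv]; abel
      subst e1 e2
      have := hC w
      tauto
    · exact absurd (by
        have := huv.trans hvw.symm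
        exact sub_left_injective this) huw
    · exact absurd (by
        have := huv.trans hvw.symm
        exact (sub_right_injective this)) huw
    · have e1 : v = u + 1 := by rw [← huv]; abel
      have e2 : w = u + 2 := by rw [h2, ← add_assoc, ← e1, ← hvw]; abel
      subst e1 e2
      have := hC u
      tauto
  rcases key with h | h | h
  · exact Ideal.mul_mem_right _ _ (Ideal.mul_mem_right _ _ (Ideal.subset_span ⟨_, h, rfl⟩))
  · exact Ideal.mul_mem_right _ _ (Ideal.mul_mem_left _ _ (Ideal.subset_span ⟨_, h, rfl⟩))
  · exact Ideal.mul_mem_left _ _ (Ideal.subset_span ⟨_, h, rfl⟩)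

lemma bound (x : Fin (N + 2)) (n : ℕ) (f : MvPolynomial (Fin (N + 2)) K)
    (hf : f ∈ symbolicPower ((pathIdeal3 K (cycleGraph (N + 2))).colon
      (Ideal.span {(X x : MvPolynomial (Fin (N + 2)) K)})) n)
    (m : Fin (N + 2) →₀ ℕ) (hm : m ∈ f.support)
    (D : Finset (Fin (N + 2))) (h0 : 0 ∉ D)
    (hD : ∀ v, v ∈ D ∨ v + 1 ∈ D ∨ v + 2 ∈ D) : n ≤ ∑ i ∈ D, m (x + i) := by
  have := cover_bound (pathIdeal3 K (cycleGraph (N + 2))) x (D.map (addLeftEmbedding x))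
    (by simpa using h0) (pathIdeal_le _ ?_) n f hf m hm
  · simpa using this
  · intro v
    have h := hD (v - x)
    have e : ∀ c, v + c ∈ D.map (addLeftEmbedding x) ↔ v - x + c ∈ D := by
      intro c
      simp only [Finset.mem_map, addLeftEmbedding_apply]
      constructor
      · rintro ⟨a, ha, h⟩
        have : v - x + c = a := by
          rw [sub_add_eq_add_sub, ← h]; abel
        rwa [this]
      · intro h
        exact ⟨_, h, by abel⟩
    have e0 := e 0
    rw [add_zero, add_zero] at e0
    rw [e0, e, e]
    exact h

lemma gen3_mem (x v : Fin (N + 3)) :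
    (X v * X (v + 1) * X (v + 2) : MvPolynomial (Fin (N + 3)) K) ∈
      pathIdeal3 K (cycleGraph (N + 3)) := by
  refine Ideal.subset_span ⟨v, v + 1, v + 2, ?_, ?_, ?_, rfl⟩
  · rw [cycleGraph_adj]; right; abel
  · rw [cycleGraph_adj]; right
    have h2 : (2 : Fin (N + 3)) = 1 + 1 := Fin.ext (Nat.add_mod 1 1 _)
    rw [h2]; abel
  · intro h
    have h1 : (2 : Fin (N + 3)) = 0 := by simpa using h.symm
    have := congrArg Fin.val h1
    rw [Fin.val_two] at this
    simp at this

lemma mem_colon3 (x v : Fin (N + 3)) :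
    (X v * X (v + 1) * X (v + 2) : MvPolynomial (Fin (N + 3)) K) ∈
      (pathIdeal3 K (cycleGraph (N + 3))).colon
      (Ideal.span {(X x : MvPolynomial (Fin (N + 3)) K)}) := by
  rw [Ideal.mem_colon_span_singleton]
  exact Ideal.mul_mem_right _ _ (gen3_mem x v)

lemma mem_colon2 (x u w v : Fin (N + 3))
    (h : (v = x ∧ v + 1 = u ∧ v + 2 = w) ∨ (v = u ∧ v + 1 = x ∧ v + 2 = w) ∨
      (v = u ∧ v + 1 = w ∧ v + 2 = x)) :
    (X u * X w : MvPolynomial (Fin (N + 3)) K) ∈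
      (pathIdeal3 K (cycleGraph (N + 3))).colon
      (Ideal.span {(X x : MvPolynomial (Fin (N + 3)) K)}) := by
  rw [Ideal.mem_colon_span_singleton]
  have hg := gen3_mem (K := K) x v
  rcases h with ⟨h1, h2, h3⟩ | ⟨h1, h2, h3⟩ | ⟨h1, h2, h3⟩ <;> rw [h2, h3, h1] at hg
  · convert hg using 1; ring
  · convert hg using 1; ring
  · exact hg

lemma monomial_shift (x : Fin (N + 3)) (m : Fin (N + 3) →₀ ℕ) :
    (monomial m (1 : K)) = ∏ i, X (x + i) ^ m (x + i) := by
  rw [monomial_eq, C_1, one_mul, Finsupp.prod_fintype _ _ (by simp)]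
  exact (Equiv.prod_comp (Equiv.addLeft x) (fun i => (X i : MvPolynomial (Fin (N + 3)) K) ^ m i)).symm

end Cyc

lemma pack9 (n a1 a2 a3 a4 a5 a6 a7 a8 : ℕ)
    (h1 : n ≤ a1 + a4 + a7) (h2 : n ≤ a2 + a5 + a8) (h3 : n ≤ a1 + a2 + a5 + a7)
    (h4 : n ≤ a1 + a3 + a5 + a7) (h5 : n ≤ a1 + a3 + a5 + a8) (h6 : n ≤ a1 + a3 + a6 + a7)
    (h7 : n ≤ a1 + a3 + a6 + a8) (h8 : n ≤ a1 + a4 + a5 + a8) (h9 : n ≤ a1 + a4 + a6 + a8)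
    (h10 : n ≤ a2 + a3 + a6 + a8) (h11 : n ≤ a2 + a4 + a6 + a8) (h12 : n ≤ a2 + a4 + a7 + a8) :
    ∃ p q r s t u v : ℕ, p + q ≤ a1 ∧ q + s ≤ a2 ∧ s + t ≤ a3 ∧ s + t + u ≤ a4 ∧
      t + u + v ≤ a5 ∧ u + v ≤ a6 ∧ v + r ≤ a7 ∧ p + r ≤ a8 ∧
      n ≤ p + q + r + s + t + u + v := by
  have inner : ∀ b2 b7 M : ℕ, M ≤ a3 + a5 → M ≤ a3 + a6 → M ≤ a4 + a5 → M ≤ a4 + a6 →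
      M ≤ a5 + b2 → M ≤ a4 + b7 → ∃ s t u v : ℕ, s ≤ b2 ∧ s + t ≤ a3 ∧ s + t + u ≤ a4 ∧
      t + u + v ≤ a5 ∧ u + v ≤ a6 ∧ v ≤ b7 ∧ M ≤ s + t + u + v := by
    intro b2 b7 M k1 k2 k3 k4 k5 k6
    obtain ⟨s, hs⟩ : ∃ s, s = min b2 (min a3 a4) := ⟨_, rfl⟩
    obtain ⟨t, ht⟩ : ∃ t, t = min (min a3 a4 - s) a5 := ⟨_, rfl⟩
    obtain ⟨u, hu⟩ : ∃ u, u = min (a4 - s - t) (min (a5 - t) a6) := ⟨_, rfl⟩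
    obtain ⟨v, hv⟩ : ∃ v, v = min b7 (min (a5 - t - u) (a6 - u)) := ⟨_, rfl⟩
    refine ⟨s, t, u, v, ?_, ?_, ?_, ?_, ?_, ?_, ?_⟩ <;> omega
  obtain ⟨M, hM⟩ : ∃ M, M = min a3 a4 + min a5 a6 := ⟨_, rfl⟩
  obtain ⟨p, hp⟩ : ∃ p, p = max (n - a5 - a2 - a7) (max (n - a4 - a7 - a2) (n - M - a2 - a7)) :=
    ⟨_, rfl⟩
  have hp1 : p ≤ a1 := by omega
  have hp8 : p ≤ a8 := by omega
  obtain ⟨q, hq⟩ : ∃ q, q = min a2 (a1 - p) := ⟨_, rfl⟩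
  obtain ⟨r, hr⟩ : ∃ r, r = min a7 (a8 - p) := ⟨_, rfl⟩
  have c1 : n ≤ p + q + r + M := by omega
  have c2 : n ≤ p + r + a5 + a2 := by omega
  have c3 : n ≤ p + q + a4 + a7 := by omega
  obtain ⟨s, t, u, v, d1, d2, d3, d4, d5, d6, d7⟩ := inner (a2 - q) (a7 - r) (n - (p + q + r))
    (by omega) (by omega) (by omega) (by omega) (by omega) (by omega)
  exact ⟨p, q, r, s, t, u, v, by omega, by omega, by omega, by omega, by omega, by omega,
    by omega, by omega, by omega⟩

lemma pack6 (n a1 a2 a3 a4 a5 : ℕ)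
    (h1 : n ≤ a1 + a4) (h2 : n ≤ a2 + a5) (h3 : n ≤ a1 + a3 + a5) :
    ∃ p q r s : ℕ, p + q ≤ a1 ∧ q + s ≤ a2 ∧ s ≤ a3 ∧ s + r ≤ a4 ∧ p + r ≤ a5 ∧
      n ≤ p + q + r + s := by
  obtain ⟨p, hp⟩ : ∃ p, p = n - a2 - a4 := ⟨_, rfl⟩
  obtain ⟨q, hq⟩ : ∃ q, q = min a2 (a1 - p) := ⟨_, rfl⟩
  obtain ⟨r, hr⟩ : ∃ r, r = min a4 (a5 - p) := ⟨_, rfl⟩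
  obtain ⟨s, hs⟩ : ∃ s, s = min (a2 - q) (min a3 (a4 - r)) := ⟨_, rfl⟩
  refine ⟨p, q, r, s, ?_, ?_, ?_, ?_, ?_, ?_⟩ <;> omega

lemma case9 (K : Type*) [Field K] (x : Fin 9) (n : ℕ) :
    symbolicPower ((pathIdeal3 K (cycleGraph 9)).colon
      (Ideal.span {(X x : MvPolynomial (Fin 9) K)})) n =
      ((pathIdeal3 K (cycleGraph 9)).colon (Ideal.span {(X x : MvPolynomial (Fin 9) K)})) ^ n := by
  apply main_of_monomial
  intro f hf m hm
  have B := bound (N := 7) x n f hf m hm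
  obtain ⟨p, q, r, s, t, u, v, d1, d2, d3, d4, d5, d6, d7, d8, d9⟩ :=
    pack9 n (m (x + 1)) (m (x + 2)) (m (x + 3)) (m (x + 4)) (m (x + 5)) (m (x + 6)) (m (x + 7))
      (m (x + 8))
      (by simpa [add_assoc] using B {1, 4, 7} (by decide) (by decide))
      (by simpa [add_assoc] using B {2, 5, 8} (by decide) (by decide))
      (by simpa [add_assoc] using B {1, 2, 5, 7} (by decide) (by decide))
      (by simpa [add_assoc] using B {1, 3, 5, 7} (by decide) (by decide))
      (by simpa [add_assoc] using B {1, 3, 5, 8} (by decide) (by decide))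
      (by simpa [add_assoc] using B {1, 3, 6, 7} (by decide) (by decide))
      (by simpa [add_assoc] using B {1, 3, 6, 8} (by decide) (by decide))
      (by simpa [add_assoc] using B {1, 4, 5, 8} (by decide) (by decide))
      (by simpa [add_assoc] using B {1, 4, 6, 8} (by decide) (by decide))
      (by simpa [add_assoc] using B {2, 3, 6, 8} (by decide) (by decide))
      (by simpa [add_assoc] using B {2, 4, 6, 8} (by decide) (by decide))
      (by simpa [add_assoc] using B {2, 4, 7, 8} (by decide) (by decide))
  clear B
  apply Ideal.pow_le_pow_right d9
  have g1 := mem_colon2 (K := K) (N := 6) x (x + 8) (x + 1) (x + 8) (by clear * -; revert x; decide)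
  have g2 := mem_colon2 (K := K) (N := 6) x (x + 1) (x + 2) x (by simp)
  have g3 := mem_colon2 (K := K) (N := 6) x (x + 7) (x + 8) (x + 7) (by clear * -; revert x; decide)
  have g4 := mem_colon3 (K := K) (N := 6) x (x + 2)
  have g5 := mem_colon3 (K := K) (N := 6) x (x + 3)
  have g6 := mem_colon3 (K := K) (N := 6) x (x + 4)
  have g7 := mem_colon3 (K := K) (N := 6) x (x + 5)
  have G := Ideal.mul_mem_mul (Ideal.mul_mem_mul (Ideal.mul_mem_mul (Ideal.mul_mem_mul
    (Ideal.mul_mem_mul (Ideal.mul_mem_mul (Ideal.pow_mem_pow g1 p) (Ideal.pow_mem_pow g2 q))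
    (Ideal.pow_mem_pow g3 r)) (Ideal.pow_mem_pow g4 s)) (Ideal.pow_mem_pow g5 t))
    (Ideal.pow_mem_pow g6 u)) (Ideal.pow_mem_pow g7 v)
  simp only [← pow_add] at G
  refine Ideal.mem_of_dvd _ ?_ G
  rw [monomial_shift (N := 6) x m]
  have e : ∀ a b c : Fin 9, a + b = c → x + a + b = x + c := by
    rintro a b c rfl; exact add_assoc _ _ _
  rw [e 2 1 3 rfl, e 2 2 4 rfl, e 3 1 4 rfl, e 3 2 5 rfl, e 4 1 5 rfl, e 4 2 6 rfl,
    e 5 1 6 rfl, e 5 2 7 rfl]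
  have hprod : (∏ i : Fin (6 + 3), (X (x + i) : MvPolynomial (Fin 9) K) ^ m (x + i)) =
      X (x + 0) ^ m (x + 0) * X (x + 1) ^ m (x + 1) * X (x + 2) ^ m (x + 2) *
      X (x + 3) ^ m (x + 3) * X (x + 4) ^ m (x + 4) * X (x + 5) ^ m (x + 5) *
      X (x + 6) ^ m (x + 6) * X (x + 7) ^ m (x + 7) * X (x + 8) ^ m (x + 8) := by
    rw [Fin.prod_univ_castSucc, Fin.prod_univ_eight]; rfl
  rw [hprod]
  generalize (X (x + 0) : MvPolynomial (Fin 9) K) ^ m (x + 0) = z0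
  generalize (X (x + 1) : MvPolynomial (Fin 9) K) = z1
  generalize (X (x + 2) : MvPolynomial (Fin 9) K) = z2
  generalize (X (x + 3) : MvPolynomial (Fin 9) K) = z3
  generalize (X (x + 4) : MvPolynomial (Fin 9) K) = z4
  generalize (X (x + 5) : MvPolynomial (Fin 9) K) = z5
  generalize (X (x + 6) : MvPolynomial (Fin 9) K) = z6
  generalize (X (x + 7) : MvPolynomial (Fin 9) K) = z7
  generalize (X (x + 8) : MvPolynomial (Fin 9) K) = z8
  refine Dvd.dvd.trans (b := 1 * z1 ^ (p + q) * z2 ^ (q + s) * z3 ^ (s + t) * z4 ^ (s + t + u) *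
    z5 ^ (t + u + v) * z6 ^ (u + v) * z7 ^ (v + r) * z8 ^ (p + r)) (dvd_of_eq (by ring)) ?_
  refine mul_dvd_mul (mul_dvd_mul (mul_dvd_mul (mul_dvd_mul (mul_dvd_mul (mul_dvd_mul
    (mul_dvd_mul (mul_dvd_mul (one_dvd _) ?_) ?_) ?_) ?_) ?_) ?_) ?_) ?_ <;>
  exact pow_dvd_pow _ (by assumption)

lemma case6 (K : Type*) [Field K] (x : Fin 6) (n : ℕ) :
    symbolicPower ((pathIdeal3 K (cycleGraph 6)).colon
      (Ideal.span {(X x : MvPolynomial (Fin 6) K)})) n =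
      ((pathIdeal3 K (cycleGraph 6)).colon (Ideal.span {(X x : MvPolynomial (Fin 6) K)})) ^ n := by
  apply main_of_monomial
  intro f hf m hm
  have B := bound (N := 4) x n f hf m hm
  obtain ⟨p, q, r, s, d1, d2, d3, d4, d5, d9⟩ :=
    pack6 n (m (x + 1)) (m (x + 2)) (m (x + 3)) (m (x + 4)) (m (x + 5))
      (by simpa [add_assoc] using B {1, 4} (by decide) (by decide))
      (by simpa [add_assoc] using B {2, 5} (by decide) (by decide))
      (by simpa [add_assoc] using B {1, 3, 5} (by decide) (by decide))
  clear B
  apply Ideal.pow_le_pow_right d9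
  have g1 := mem_colon2 (K := K) (N := 3) x (x + 5) (x + 1) (x + 5) (by clear * -; revert x; decide)
  have g2 := mem_colon2 (K := K) (N := 3) x (x + 1) (x + 2) x (by simp)
  have g3 := mem_colon2 (K := K) (N := 3) x (x + 4) (x + 5) (x + 4) (by clear * -; revert x; decide)
  have g4 := mem_colon3 (K := K) (N := 3) x (x + 2)
  have G := Ideal.mul_mem_mul (Ideal.mul_mem_mul (Ideal.mul_mem_mul (Ideal.pow_mem_pow g1 p)
    (Ideal.pow_mem_pow g2 q)) (Ideal.pow_mem_pow g3 r)) (Ideal.pow_mem_pow g4 s)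
  simp only [← pow_add] at G
  refine Ideal.mem_of_dvd _ ?_ G
  rw [monomial_shift (N := 3) x m]
  have e : ∀ a b c : Fin 6, a + b = c → x + a + b = x + c := by
    rintro a b c rfl; exact add_assoc _ _ _
  rw [e 2 1 3 rfl, e 2 2 4 rfl]
  have hprod : (∏ i : Fin (3 + 3), (X (x + i) : MvPolynomial (Fin 6) K) ^ m (x + i)) =
      X (x + 0) ^ m (x + 0) * X (x + 1) ^ m (x + 1) * X (x + 2) ^ m (x + 2) *
      X (x + 3) ^ m (x + 3) * X (x + 4) ^ m (x + 4) * X (x + 5) ^ m (x + 5) := by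
    exact Fin.prod_univ_six _
  rw [hprod]
  generalize (X (x + 0) : MvPolynomial (Fin 6) K) ^ m (x + 0) = z0
  generalize (X (x + 1) : MvPolynomial (Fin 6) K) = z1
  generalize (X (x + 2) : MvPolynomial (Fin 6) K) = z2
  generalize (X (x + 3) : MvPolynomial (Fin 6) K) = z3
  generalize (X (x + 4) : MvPolynomial (Fin 6) K) = z4
  generalize (X (x + 5) : MvPolynomial (Fin 6) K) = z5
  refine Dvd.dvd.trans (b := 1 * z1 ^ (p + q) * z2 ^ (q + s) * z3 ^ s * z4 ^ (s + r) *
    z5 ^ (p + r)) (dvd_of_eq (by ring)) ?_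
  refine mul_dvd_mul (mul_dvd_mul (mul_dvd_mul (mul_dvd_mul
    (mul_dvd_mul (one_dvd _) ?_) ?_) ?_) ?_) ?_ <;>
  exact pow_dvd_pow _ (by assumption)

lemma case3 (K : Type*) [Field K] (x : Fin 3) (n : ℕ) :
    symbolicPower ((pathIdeal3 K (cycleGraph 3)).colon
      (Ideal.span {(X x : MvPolynomial (Fin 3) K)})) n =
      ((pathIdeal3 K (cycleGraph 3)).colon (Ideal.span {(X x : MvPolynomial (Fin 3) K)})) ^ n := by
  apply main_of_monomial
  intro f hf m hm
  have B := bound (N := 1) x n f hf m hm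
  have h1 : n ≤ m (x + 1) := by simpa using B {1} (by decide) (by decide)
  have h2 : n ≤ m (x + 2) := by simpa using B {2} (by decide) (by decide)
  have g2 := mem_colon2 (K := K) (N := 0) x (x + 1) (x + 2) x (by simp)
  refine Ideal.mem_of_dvd _ ?_ (Ideal.pow_mem_pow g2 n)
  rw [monomial_shift (N := 0) x m]
  have hprod : (∏ i : Fin (0 + 3), (X (x + i) : MvPolynomial (Fin 3) K) ^ m (x + i)) =
      X (x + 0) ^ m (x + 0) * X (x + 1) ^ m (x + 1) * X (x + 2) ^ m (x + 2) := by
    exact Fin.prod_univ_three _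
  rw [hprod, mul_pow, mul_assoc]
  exact Dvd.dvd.mul_left (mul_dvd_mul (pow_dvd_pow _ h1) (pow_dvd_pow _ h2)) _

/-- Let `k ∈ {1, 2, 3}`, let `J = I₃(C_{3k})` be the cubic path ideal of
the cycle `C_{3k}` and let `x` be any variable (vertex) of `C_{3k}`. Then
`(J : x)⁽ⁿ⁾ = (J : x)ⁿ` for all `n ≥ 1`. -/
theorem colon_symbolicPower_eq_of_cycle3k_small
    (K : Type*) [Field K] (k : ℕ) (hk : k = 1 ∨ k = 2 ∨ k = 3) (x : Fin (3 * k)) :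
    ∀ n : ℕ, 1 ≤ n →
      symbolicPower
          ((pathIdeal3 K (cycleGraph (3 * k))).colon
            (Ideal.span {(X x : MvPolynomial (Fin (3 * k)) K)})) n =
        ((pathIdeal3 K (cycleGraph (3 * k))).colon
          (Ideal.span {(X x : MvPolynomial (Fin (3 * k)) K)})) ^ n := by
  intro n _
  rcases hk with rfl | rfl | rfl
  · exact case3 K x n
  · exact case6 K x n
  · exact case9 K x n
end

section
/- Let k ∈ {1, 2, 3} and let J = I_3(C_{3k}) be the cubic path ideal of the cycle C_{3k} in a polynomial ring over a field. Then J^(n) = J^n for all n ≥ 1. -/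
open MvPolynomial SimpleGraph

def pDisp : List Bool → ℤ
  | [] => 0
  | true :: l => 3 + pDisp l
  | false :: l => -1 + pDisp l

def pHeads : ℤ → List Bool → List ℤ
  | _, [] => []
  | i, true :: l => (i + 3) :: pHeads (i + 3) l
  | i, false :: l => pHeads (i - 1) l

def pCost {m : ℕ} (a : ZMod m → ℕ) (i : ℤ) (l : List Bool) : ℕ :=
  ((pHeads i l).map (fun h : ℤ => a (h : ZMod m))).sum

lemma pDisp_append (l l' : List Bool) : pDisp (l ++ l') = pDisp l + pDisp l' := by
  induction l with
  | nil => simp [pDisp]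
  | cons b l ih => cases b <;> simp [pDisp, ih] <;> ring

lemma pHeads_append (i : ℤ) (l l' : List Bool) :
    pHeads i (l ++ l') = pHeads i l ++ pHeads (i + pDisp l) l' := by
  induction l generalizing i with
  | nil => simp [pDisp, pHeads]
  | cons b l ih =>
    cases b <;> simp [pDisp, pHeads, ih] <;> congr 1 <;> ring

lemma pCost_append {m : ℕ} (a : ZMod m → ℕ) (i : ℤ) (l l' : List Bool) :
    pCost a i (l ++ l') = pCost a i l + pCost a (i + pDisp l) l' := by
  simp [pCost, pHeads_append]

lemma pCost_congr {m : ℕ} (a : ZMod m → ℕ) (i j : ℤ) (h : (i : ZMod m) = j) (l : List Bool) :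
    pCost a i l = pCost a j l := by
  induction l generalizing i j with
  | nil => simp [pCost, pHeads]
  | cons b l ih =>
    cases b
    · exact ih (i - 1) (j - 1) (by push_cast; rw [h])
    · have h3 : ((i + 3 : ℤ) : ZMod m) = ((j + 3 : ℤ) : ZMod m) := by push_cast; rw [h]
      have := ih (i + 3) (j + 3) h3
      simp only [pCost, pHeads, List.map_cons, List.sum_cons] at this ⊢
      rw [this, h3]

lemma pDisp_replicate_false (q : ℕ) : pDisp (List.replicate q false) = -q := by
  induction q with
  | zero => simp [pDisp]
  | succ q ih => simp [List.replicate_succ, pDisp, ih]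

lemma pDisp_replicate_true (q : ℕ) : pDisp (List.replicate q true) = 3 * q := by
  induction q with
  | zero => simp [pDisp]
  | succ q ih => simp [List.replicate_succ, pDisp, ih]; ring

lemma pCost_replicate_false {m : ℕ} (a : ZMod m → ℕ) (i : ℤ) (q : ℕ) :
    pCost a i (List.replicate q false) = 0 := by
  induction q generalizing i with
  | zero => simp [pCost, pHeads]
  | succ q ih =>
    have := ih (i - 1)
    simpa [List.replicate_succ, pCost, pHeads] using this

lemma pDisp_count (l : List Bool) : pDisp l = 3 * l.count true - l.count false := by
  induction l with
  | nil => simp [pDisp]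
  | cons b l ih => cases b <;> simp [pDisp, ih] <;> ring

lemma pHeads_cross (l : List Bool) (i j : ℤ) (h1 : i < j) (h2 : j ≤ i + pDisp l) :
    ∃ h ∈ pHeads i l, j ≤ h ∧ h ≤ j + 2 := by
  induction l generalizing i with
  | nil => simp [pDisp] at h2; omega
  | cons b l ih =>
    cases b
    · simp only [pDisp] at h2
      exact ih (i - 1) (by omega) (by omega)
    · simp only [pDisp] at h2
      by_cases h : i + 3 < j
      · obtain ⟨x, hx, h'⟩ := ih (i + 3) h (by omega)
        exact ⟨x, by simp [pHeads, hx], h'⟩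
      · exact ⟨i + 3, by simp [pHeads], by omega, by omega⟩

lemma pSum_toFinset_le {α : Type*} [DecidableEq α] (a : α → ℕ) (L : List α) :
    ∑ v ∈ L.toFinset, a v ≤ (L.map a).sum := by
  induction L with
  | nil => simp
  | cons x L ih =>
    simp only [List.toFinset_cons, List.map_cons, List.sum_cons]
    by_cases h : x ∈ L.toFinset
    · rw [Finset.insert_eq_of_mem h]; omega
    · rw [Finset.sum_insert h]; omega

def pCover {m : ℕ} (C : Finset (ZMod m)) : Prop := ∀ v, v ∈ C ∨ v + 1 ∈ C ∨ v + 2 ∈ C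

lemma pCost_one {m : ℕ} [NeZero m] (a : ZMod m → ℕ) (n : ℕ)
    (ha : ∀ C : Finset (ZMod m), pCover C → n ≤ ∑ v ∈ C, a v) (i : ℤ) (l : List Bool)
    (hl : pDisp l = m) : n ≤ pCost a i l := by
  have hm : (0 : ℤ) < m := by exact_mod_cast Nat.pos_of_ne_zero (NeZero.ne m)
  refine (ha ((pHeads i l).map (fun h : ℤ => (h : ZMod m))).toFinset ?_).trans
    ((pSum_toFinset_le _ _).trans (le_of_eq ?_))
  · intro v
    obtain ⟨v, rfl⟩ := ZMod.intCast_surjective v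
    obtain ⟨x, hx, h1, h2⟩ := pHeads_cross l i (i + 1 + (v - i - 1) % m)
      (by have := Int.emod_nonneg (v - i - 1) hm.ne'; omega)
      (by have := Int.emod_lt_of_pos (v - i - 1) hm; omega)
    have hc : ((i + 1 + (v - i - 1) % m : ℤ) : ZMod m) = v := by
      push_cast
      ring
    have hmem : (x : ZMod m) ∈ ((pHeads i l).map (fun h : ℤ => (h : ZMod m))).toFinset := by
      simp only [List.mem_toFinset, List.mem_map]; exact ⟨x, hx, rfl⟩
    rw [← hc]
    obtain h | h | h : x = i + 1 + (v - i - 1) % m ∨ x = (i + 1 + (v - i - 1) % m) + 1 ∨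
      x = (i + 1 + (v - i - 1) % m) + 2 := by omega
    · left; rw [← h]; exact hmem
    · right; left; rw [h] at hmem; simpa only [Int.cast_add, Int.cast_one] using hmem
    · right; right; rw [h] at hmem; simpa only [Int.cast_add, Int.cast_ofNat] using hmem
  · simp [pCost, Function.comp_def]

lemma pSplit {k : ℕ} (hk0 : 0 < k) (hk : k ≤ 3) (l : List Bool) (w : ℤ) (hw : 2 ≤ w)
    (hl : pDisp l = (3 * k : ℕ) * w) :
    ∃ l1 l2 l3 : List Bool, l = l1 ++ l2 ++ l3 ∧ l2.length < l.length ∧ 0 < l2.length ∧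
      ∃ w', pDisp l2 = (3 * k : ℕ) * w' := by
  have : NeZero (3 * k) := ⟨by omega⟩
  by_cases h : 3 * k < l.length
  · obtain ⟨s, t, hst, he⟩ := Fintype.exists_ne_map_eq_of_card_lt
      (fun t : Fin (3 * k + 1) => ((pDisp (l.take t) : ℤ) : ZMod (3 * k)))
      (by simp [ZMod.card])
    wlog hlt : s < t generalizing s t
    · exact this t s hst.symm he.symm (lt_of_le_of_ne (not_lt.mp hlt) hst.symm)
    have hlt' : (s : ℕ) < t := hlt
    have ht := t.2
    have e1 : l.take t = l.take s ++ (l.take t).drop s := by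
      conv_lhs => rw [← List.take_append_drop s (l.take t)]
      rw [List.take_take, min_eq_left hlt'.le]
    refine ⟨l.take s, (l.take t).drop s, l.drop t, ?_, ?_, ?_, ?_⟩
    · rw [← e1, List.take_append_drop]
    · simp; omega
    · simp; omega
    · rw [e1, pDisp_append] at he
      have : ((pDisp ((l.take t).drop s) : ℤ) : ZMod (3 * k)) = 0 := by
        push_cast at he
        simpa using he
      rw [ZMod.intCast_zmod_eq_zero_iff_dvd] at this
      exact this
  · have hc := List.count_true_add_count_false (l := l)
    rw [pDisp_count] at hl
    have hq : l.count false = 0 := by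
      have : w ≤ 3 := by
        by_contra hcon
        have : (4 : ℤ) ≤ w := by omega
        obtain rfl | rfl | rfl : k = 1 ∨ k = 2 ∨ k = 3 := by omega
        all_goals push_cast at hl; omega
      obtain rfl | rfl | rfl : k = 1 ∨ k = 2 ∨ k = 3 := by omega
      all_goals push_cast at hl; omega
    have hp : 2 * k ≤ l.count true := by
      have : (k : ℤ) * 2 ≤ k * w := by gcongr
      push_cast at hl
      rw [hq] at hl
      push_cast at hl
      have : (3 * k : ℤ) * w = 3 * (k * w) := by ring
      omega
    have hrep : l = List.replicate l.length true := by
      rw [List.eq_replicate_iff]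
      refine ⟨rfl, fun b hb => ?_⟩
      cases b
      · rw [List.count_eq_zero] at hq; exact absurd hb hq
      · rfl
    refine ⟨[], List.replicate k true, List.replicate (l.length - k) true, ?_, ?_, ?_, 1, ?_⟩
    · rw [List.nil_append, List.replicate_append_replicate]
      rw [show k + (l.length - k) = l.length by omega]; exact hrep
    · simp; omega
    · simpa using hk0
    · rw [pDisp_replicate_true]; push_cast; ring

lemma pCost_closed {k : ℕ} (hk0 : 0 < k) (hk : k ≤ 3) (a : ZMod (3 * k) → ℕ) (n : ℕ)
    (ha : ∀ C : Finset (ZMod (3 * k)), pCover C → n ≤ ∑ v ∈ C, a v) (N : ℕ) :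
    ∀ (l : List Bool) (_ : l.length ≤ N) (i w : ℤ) (_ : pDisp l = (3 * k : ℕ) * w),
      (n : ℤ) * w ≤ pCost a i l := by
  have : NeZero (3 * k) := ⟨by omega⟩
  induction N with
  | zero =>
    intro l hN i w hl
    have : l = [] := by simpa using hN
    subst this
    have : w = 0 := by
      simp [pDisp] at hl; omega
    simp [this]
  | succ N ih =>
    intro l hN i w hl
    by_cases h0 : w ≤ 0
    · have : (n : ℤ) * w ≤ 0 := mul_nonpos_of_nonneg_of_nonpos (by positivity) h0
      have : (0 : ℤ) ≤ pCost a i l := by positivity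
      omega
    by_cases h1 : w = 1
    · subst h1
      have := pCost_one a n ha i l (by simpa using hl)
      simpa using this
    obtain ⟨l1, l2, l3, rfl, h2, h3, w', hw'⟩ := pSplit hk0 hk l w (by omega) hl
    have hd : pDisp (l1 ++ l3) = (3 * k : ℕ) * (w - w') := by
      simp only [pDisp_append] at hl ⊢
      rw [mul_sub, ← hw', ← hl]; ring
    have i1 := ih (l1 ++ l3) (by simp at hN ⊢; omega) i _ hd
    have i2 := ih l2 (by omega) (i + pDisp l1) w' hw'
    rw [pCost_append] at i1
    rw [pCost_append, pCost_append, pCost_congr a (i + pDisp (l1 ++ l2)) (i + pDisp l1)]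
    · push_cast at i1 ⊢
      linarith
    · rw [pDisp_append, hw', ← add_assoc, Int.cast_add, Int.cast_mul, Int.cast_natCast,
        ZMod.natCast_self, zero_mul, add_zero]

lemma pPotential {k : ℕ} (hk0 : 0 < k) (hk : k ≤ 3) (a : ZMod (3 * k) → ℕ) (n : ℕ)
    (ha : ∀ C : Finset (ZMod (3 * k)), pCover C → n ≤ ∑ v ∈ C, a v) :
    ∃ z : ℤ → ℤ, (∀ j, z (j + (3 * k : ℕ)) = z j + n) ∧ (∀ j, z j ≤ z (j + 1)) ∧
      ∀ j, z (j + 3) ≤ z j + a ((j + 3 : ℤ) : ZMod (3 * k)) := by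
  let P : ℤ → ℤ → Prop := fun j c =>
    ∃ l w, pDisp l = j + (3 * k : ℕ) * w ∧ c = pCost a 0 l - n * w
  have hm : (0 : ℤ) < (3 * k : ℕ) := by exact_mod_cast (by omega : 0 < 3 * k)
  have hmin : ∀ j, ∃ c, P j c ∧ ∀ c', P j c' → c ≤ c' := by
    intro j
    apply Int.exists_least_of_bdd
    · refine ⟨n * (j / (3 * k : ℕ)), ?_⟩
      rintro c ⟨l, w, hl, rfl⟩
      have hr := Int.emod_nonneg j hm.ne'
      have hd := Int.mul_ediv_add_emod j (3 * k : ℕ)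
      have := pCost_closed hk0 hk a n ha _
        (l ++ List.replicate (j % (3 * k : ℕ)).toNat false) le_rfl 0 (w + j / (3 * k : ℕ)) (by
          rw [pDisp_append, pDisp_replicate_false, Int.toNat_of_nonneg hr, hl, mul_add]
          linarith)
      rw [pCost_append, pCost_replicate_false] at this
      push_cast at this ⊢
      linarith
    · have hle : j + (3 * k : ℕ) * (-|j|) ≤ 0 := by
        have := le_abs_self j
        have := abs_nonneg j
        nlinarith
      refine ⟨_, List.replicate (-(j + (3 * k : ℕ) * (-|j|))).toNat false, -|j|, ?_, rfl⟩
      rw [pDisp_replicate_false, Int.toNat_of_nonneg (by omega)]; ring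
  choose z hz hz' using hmin
  refine ⟨z, fun j => le_antisymm ?_ ?_, fun j => ?_, fun j => ?_⟩
  · apply hz'
    obtain ⟨l, w, h1, h2⟩ := hz j
    exact ⟨l, w - 1, by rw [h1]; ring, by rw [h2]; ring⟩
  · rw [← le_sub_iff_add_le]
    apply hz'
    obtain ⟨l, w, h1, h2⟩ := hz (j + (3 * k : ℕ))
    exact ⟨l, w + 1, by rw [h1]; ring, by rw [h2]; ring⟩
  · apply hz'
    obtain ⟨l, w, h1, h2⟩ := hz (j + 1)
    refine ⟨l ++ [false], w, by rw [pDisp_append, h1]; simp [pDisp]; ring, ?_⟩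
    rw [h2, pCost_append]; simp [pCost, pHeads]
  · apply hz'
    obtain ⟨l, w, h1, h2⟩ := hz j
    refine ⟨l ++ [true], w, by rw [pDisp_append, h1]; simp [pDisp]; ring, ?_⟩
    rw [h2, pCost_append, h1]; simp [pCost, pHeads]
    have : (3 : ZMod (3 * k)) * k = 0 := by exact_mod_cast ZMod.natCast_self (3 * k)
    rw [this]; simp; ring

lemma pPacking {k : ℕ} [NeZero (3 * k)] (hk0 : 0 < k) (hk : k ≤ 3) (a : ZMod (3 * k) → ℕ) (n : ℕ)
    (ha : ∀ C : Finset (ZMod (3 * k)), pCover C → n ≤ ∑ v ∈ C, a v) :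
    ∃ y : ZMod (3 * k) → ℕ, ∑ v, y v = n ∧ ∀ v, y v + y (v - 1) + y (v - 2) ≤ a v := by
  obtain ⟨z, h1, h2, h3⟩ := pPotential hk0 hk a n ha
  have hper : ∀ (r : ℤ) (j : ℤ), z (j + (3 * k : ℕ) * r) = z j + n * r := by
    intro r
    induction r using Int.induction_on with
    | zero => simp
    | succ r ih =>
      intro j
      rw [show j + (3 * k : ℕ) * ((r : ℤ) + 1) = j + (3 * k : ℕ) * (r : ℤ) + (3 * k : ℕ) by ring, h1, ih]
      ring
    | pred r ih =>
      intro j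
      have := h1 (j + (3 * k : ℕ) * (-(r : ℤ) - 1))
      rw [show j + (3 * k : ℕ) * (-(r : ℤ) - 1) + (3 * k : ℕ) = j + (3 * k : ℕ) * (-(r : ℤ)) by ring, ih] at this
      linarith
  let d : ℤ → ℤ := fun j => z j - z (j - 1)
  have hd : ∀ i j : ℤ, (i : ZMod (3 * k)) = j → d i = d j := by
    intro i j hij
    rw [ZMod.intCast_eq_intCast_iff_dvd_sub] at hij
    obtain ⟨r, hr⟩ := hij
    obtain rfl : j = i + (3 * k : ℕ) * r := by omega
    simp only [d]
    rw [show i + (3 * k : ℕ) * r - 1 = (i - 1) + (3 * k : ℕ) * r by ring, hper, hper]; ring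
  have hd0 : ∀ j, 0 ≤ d j := by
    intro j
    have := h2 (j - 1)
    simp only [sub_add_cancel] at this
    simp only [d]; omega
  let y : ZMod (3 * k) → ℕ := fun v => (d v.val).toNat
  have hy : ∀ j : ℤ, (y (j : ZMod (3 * k)) : ℤ) = d j := by
    intro j
    simp only [y]
    rw [Int.toNat_of_nonneg (hd0 _)]
    apply hd
    simp
  refine ⟨y, ?_, ?_⟩
  · have hs : ∀ N : ℕ, ∑ t ∈ Finset.range N, d ((t : ℤ) + 1) = z N - z 0 := by
      intro N
      induction N with
      | zero => simp
      | succ N ih => rw [Finset.sum_range_succ, ih]; simp [d]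
    have e : ∑ v, y v = ∑ t ∈ Finset.range (3 * k), y (((t : ℤ) + 1 : ℤ) : ZMod (3 * k)) := by
      rw [← Equiv.sum_comp (Equiv.addRight (1 : ZMod (3 * k))) y]
      refine Finset.sum_bij' (fun v _ => v.val) (fun t _ => (t : ZMod (3 * k))) ?_ ?_ ?_ ?_ ?_
      · intro v _; simpa using ZMod.val_lt v
      · intro t _; simp
      · intro v _; simp
      · intro t ht; exact ZMod.val_cast_of_lt (by simpa using ht)
      · intro v _; simp
    have : ((∑ v, y v : ℕ) : ℤ) = n := by
      rw [e]
      push_cast only [Nat.cast_sum]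
      simp only [hy]
      rw [hs]
      have := h1 0
      rw [zero_add] at this
      omega
    exact_mod_cast this
  · intro v
    obtain ⟨j, rfl⟩ := ZMod.intCast_surjective v
    have e0 := hy j
    have e1 := hy (j - 1)
    have e2 := hy (j - 2)
    have := h3 (j - 3)
    push_cast at e1 e2
    simp only [sub_add_cancel] at this
    simp only [d] at e0 e1 e2
    rw [show j - 1 - 1 = j - 2 by ring] at e1
    rw [show j - 2 - 1 = j - 3 by ring] at e2
    omega

lemma pPow_le {σ K : Type*} [Field K] (C : Finset σ) (n : ℕ) :
    (Ideal.span (X '' (C : Set σ)) : Ideal (MvPolynomial σ K)) ^ n ≤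
      Ideal.span ((fun s => monomial s (1 : K)) '' {a : σ →₀ ℕ | n ≤ ∑ v ∈ C, a v}) := by
  classical
  induction n with
  | zero =>
    intro f _
    rw [mem_ideal_span_monomial_image]
    exact fun xi _ => ⟨xi, by simp, le_rfl⟩
  | succ n ih =>
    rw [pow_succ]
    refine (Ideal.mul_mono_left ih).trans ?_
    rw [Ideal.span_mul_span', Ideal.span_le]
    rintro _ ⟨_, ⟨a, ha, rfl⟩, _, ⟨v, hv, rfl⟩, rfl⟩
    refine Ideal.subset_span ⟨a + Finsupp.single v 1, ?_, ?_⟩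
    · have hv' : v ∈ C := hv
      have ha' : n ≤ ∑ v ∈ C, a v := ha
      have : ∑ u ∈ C, (Finsupp.single v 1 : σ →₀ ℕ) u = 1 := by
        simp [Finsupp.single_apply, hv']
      simp only [Set.mem_ofPred_eq, Finsupp.add_apply, Finset.sum_add_distrib, this]
      omega
    · simp [X, monomial_mul]

lemma pSymb_mem {σ K : Type*} [Field K] (J : Ideal (MvPolynomial σ K)) (C : Finset σ) (n : ℕ)
    (hJ : ∀ φ : MvPolynomial σ K →ₐ[K] MvPolynomial σ K, (∀ v ∈ C, φ (X v) = 0) →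
      J ≤ RingHom.ker φ.toRingHom)
    (f : MvPolynomial σ K) (hf : f ∈ symbolicPower J n) (a : σ →₀ ℕ) (ha : a ∈ f.support) :
    n ≤ ∑ v ∈ C, a v := by
  classical
  let φ : MvPolynomial σ K →ₐ[K] MvPolynomial σ K := aeval (fun v => if v ∈ C then 0 else X v)
  have hφ : ∀ v ∈ C, φ (X v) = 0 := by
    intro v hv; simp [φ, hv]
  have hker : RingHom.ker φ.toRingHom ≤ Ideal.span (X '' (C : Set σ)) := by
    intro g hg
    have hc : ((Ideal.Quotient.mk (Ideal.span (X '' (C : Set σ)) : Ideal (MvPolynomial σ K))).comp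
        φ.toRingHom) = Ideal.Quotient.mk _ := by
      apply MvPolynomial.ringHom_ext
      · intro r; simp [φ]
      · intro v
        by_cases hv : v ∈ C
        · have : (Ideal.Quotient.mk (Ideal.span (X '' (C : Set σ)) : Ideal (MvPolynomial σ K)))
              (X v) = 0 :=
            Ideal.Quotient.eq_zero_iff_mem.mpr (Ideal.subset_span ⟨v, hv, rfl⟩)
          rw [this]; simp [φ, hv]
        · simp [φ, hv]
    rw [← Ideal.Quotient.eq_zero_iff_mem, ← hc, RingHom.comp_apply, RingHom.mem_ker.mp hg, map_zero]
  have hp : (RingHom.ker φ.toRingHom).IsPrime := RingHom.ker_isPrime _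
  obtain ⟨p, hp1, hp2⟩ := Ideal.exists_minimalPrimes_le (hJ φ hφ)
  have h1 : f ∈ p ^ n := by
    simp only [symbolicPower, Ideal.mem_iInf] at hf
    exact hf p hp1
  have h2 := pPow_le C n (Ideal.pow_right_mono (hp2.trans hker) n h1)
  rw [mem_ideal_span_monomial_image] at h2
  obtain ⟨s, hs, hsa⟩ := h2 a ha
  exact le_trans hs (Finset.sum_le_sum fun v _ => hsa v)

lemma pMain (K : Type*) [Field K] (k : ℕ) (hk0 : 0 < k) (hk : k ≤ 3)
    (J : Ideal (MvPolynomial (ZMod (3 * k)) K))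
    (hJ : J = Ideal.span (Set.range fun v : ZMod (3 * k) => X v * X (v + 1) * X (v + 2))) (n : ℕ) :
    symbolicPower J n = J ^ n := by
  classical
  have hne : NeZero (3 * k) := ⟨by omega⟩
  apply le_antisymm
  · intro f hf
    rw [f.as_sum]
    refine Ideal.sum_mem _ fun a ha => ?_
    obtain ⟨y, hy1, hy2⟩ := pPacking hk0 hk a n (by
      intro C hC
      refine pSymb_mem J C n ?_ f hf a ha
      intro φ hφ
      rw [hJ, Ideal.span_le]
      rintro _ ⟨v, rfl⟩
      change φ _ = 0
      rw [map_mul, map_mul]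
      rcases hC v with h | h | h <;> simp [hφ _ h])
    have hprod : ∏ v, (X v * X (v + 1) * X (v + 2) : MvPolynomial (ZMod (3 * k)) K) ^ y v ∈ J ^ n := by
      rw [← hy1, ← Finset.prod_pow_eq_pow_sum]
      refine Ideal.prod_mem_prod fun v _ => Ideal.pow_mem_pow ?_ _
      rw [hJ]
      exact Ideal.subset_span ⟨v, rfl⟩
    have heq : ∏ v, (X v * X (v + 1) * X (v + 2) : MvPolynomial (ZMod (3 * k)) K) ^ y v =
        ∏ v, X v ^ (y v + y (v - 1) + y (v - 2)) := by
      simp only [mul_pow, pow_add, Finset.prod_mul_distrib]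
      congr 1
      · congr 1
        rw [← Equiv.prod_comp (Equiv.addRight (1 : ZMod (3 * k)))
          (fun v => (X v : MvPolynomial (ZMod (3 * k)) K) ^ y (v - 1))]
        simp
      · rw [← Equiv.prod_comp (Equiv.addRight (2 : ZMod (3 * k)))
          (fun v => (X v : MvPolynomial (ZMod (3 * k)) K) ^ y (v - 2))]
        simp
    refine Ideal.mem_of_dvd _ ?_ hprod
    rw [heq, monomial_eq, Finsupp.prod_fintype _ _ (by simp)]
    exact Dvd.dvd.mul_left (Finset.prod_dvd_prod_of_dvd _ _ fun v _ => pow_dvd_pow _ (hy2 v)) _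
  · simp only [symbolicPower]
    refine le_iInf₂ fun p hp => Ideal.pow_right_mono hp.1.2 n

lemma pPath (K : Type*) [Field K] (m : ℕ) (G : SimpleGraph (ZMod m))
    (h1 : ∀ v, G.Adj v (v + 1)) (h2 : ∀ v : ZMod m, v ≠ v + 2)
    (h3 : ∀ u v, G.Adj u v → v = u + 1 ∨ u = v + 1) :
    pathIdeal3 K G = Ideal.span (Set.range fun v : ZMod m => X v * X (v + 1) * X (v + 2)) := by
  unfold pathIdeal3
  congr 1
  ext f
  constructor
  · rintro ⟨u, v, w, huv, hvw, hne, rfl⟩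
    rcases h3 _ _ huv with rfl | rfl <;> rcases h3 _ _ hvw with rfl | h
    · exact ⟨u, by rw [add_assoc, one_add_one_eq_two]⟩
    · exact absurd (add_right_cancel h) hne
    · exact absurd rfl hne
    · subst h
      refine ⟨w, ?_⟩
      rw [show w + 1 + 1 = w + 2 by rw [add_assoc, one_add_one_eq_two]]
      ring
  · rintro ⟨v, rfl⟩
    refine ⟨v, v + 1, v + 2, h1 v, ?_, h2 v, rfl⟩
    have := h1 (v + 1)
    rwa [add_assoc, one_add_one_eq_two] at this

/-- Let `k ∈ {1, 2, 3}` and let `J = I₃(C_{3k})` be the cubic path ideal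
of the cycle `C_{3k}`. Then `J⁽ⁿ⁾ = Jⁿ` for all `n ≥ 1`. -/
theorem symbolicPower_eq_pow_of_cycle3k_small
    (K : Type*) [Field K] (k : ℕ) (hk : k = 1 ∨ k = 2 ∨ k = 3) :
    ∀ n : ℕ, 1 ≤ n →
      symbolicPower (pathIdeal3 K (cycleGraph (3 * k))) n =
        (pathIdeal3 K (cycleGraph (3 * k))) ^ n := by
  intro n _
  rcases hk with rfl | rfl | rfl
  · exact pMain K 1 (by norm_num) (by norm_num) _
      (pPath K (3 * 1) (cycleGraph (3 * 1))
        (by change ∀ v : Fin 3, (cycleGraph 3).Adj v (v + 1); decide) (by decide)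
        (by change ∀ u v : Fin 3, (cycleGraph 3).Adj u v → v = u + 1 ∨ u = v + 1; decide)) n
  · exact pMain K 2 (by norm_num) (by norm_num) _
      (pPath K (3 * 2) (cycleGraph (3 * 2))
        (by change ∀ v : Fin 6, (cycleGraph 6).Adj v (v + 1); decide) (by decide)
        (by change ∀ u v : Fin 6, (cycleGraph 6).Adj u v → v = u + 1 ∨ u = v + 1; decide)) n
  · exact pMain K 3 (by norm_num) (by norm_num) _
      (pPath K (3 * 3) (cycleGraph (3 * 3))
        (by change ∀ v : Fin 9, (cycleGraph 9).Adj v (v + 1); decide) (by decide)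
        (by change ∀ u v : Fin 9, (cycleGraph 9).Adj u v → v = u + 1 ∨ u = v + 1; decide)) n
end

section
/- Let G be a finite connected simple graph and let J = I_3(G) be the cubic path ideal of G in a polynomial ring over a field. Then J^(n) = J^n for all n ≥ 1 if and only if G is isomorphic to a path graph P_m (for some m ≥ 1) or G is isomorphic to the cycle C_{3k} for some k ∈ {1, 2, 3}. -/
open MvPolynomial SimpleGraph

namespace CPI

/-- `C` meets every hyperedge. -/
def IsCover {V : Type*} (E : Set (Finset V)) (C : Finset V) : Prop :=
  ∀ T ∈ E, ∃ v ∈ T, v ∈ C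

/-- `a` dominates a sum of `n` indicator functions of hyperedges. -/
inductive Pack {V : Type*} [DecidableEq V] (E : Set (Finset V)) : ℕ → (V → ℕ) → Prop
  | zero (a : V → ℕ) : Pack E 0 a
  | succ (T : Finset V) (n : ℕ) (a b : V → ℕ) : T ∈ E → Pack E n a →
      (∀ v, b v = a v + if v ∈ T then 1 else 0) → Pack E (n + 1) b

/-- The max-flow min-cut (Mengerian) property. -/
def MFMC {V : Type*} [DecidableEq V] (E : Set (Finset V)) : Prop :=
  ∀ (n : ℕ) (a : V → ℕ), (∀ C, IsCover E C → n ≤ ∑ v ∈ C, a v) → Pack E n a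

/-- The vertex sets of paths on three vertices. -/
def triples {V : Type*} [DecidableEq V] (G : SimpleGraph V) : Set (Finset V) :=
  {T | ∃ u v w, G.Adj u v ∧ G.Adj v w ∧ u ≠ w ∧ T = {u, v, w}}

section algebra

variable {V : Type*} [Fintype V] [DecidableEq V] {K : Type*} [Field K]

/-- The ideal of polynomials all of whose monomials have weight at least `t`. -/
def wtIdeal (K : Type*) [Field K] (w : V → ℕ) (t : ℕ) : Ideal (MvPolynomial V K) where
  carrier := {f | ∀ m ∈ f.support, t ≤ ∑ v, w v * m v}
  add_mem' := by
    intro f g hf hg m hm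
    rcases Finset.mem_union.1 (MvPolynomial.support_add hm) with h | h
    · exact hf m h
    · exact hg m h
  zero_mem' := by intro m hm; simp at hm
  smul_mem' := by
    intro c f hf m hm
    rw [smul_eq_mul] at hm
    obtain ⟨x, hx, y, hy, rfl⟩ := Finset.mem_add.1 (MvPolynomial.support_mul c f hm)
    have := hf y hy
    refine this.trans (Finset.sum_le_sum fun v _ => Nat.mul_le_mul_left _ ?_)
    simp

lemma mem_wtIdeal (w : V → ℕ) (t : ℕ) (f : MvPolynomial V K) :
    f ∈ wtIdeal K w t ↔ ∀ m ∈ f.support, t ≤ ∑ v, w v * m v := Iff.rfl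

lemma wtIdeal_mul (w : V → ℕ) (s t : ℕ) :
    wtIdeal K w s * wtIdeal K w t ≤ wtIdeal K w (s + t) := by
  rw [Ideal.mul_le]
  intro f hf g hg m hm
  obtain ⟨x, hx, y, hy, rfl⟩ := Finset.mem_add.1 (MvPolynomial.support_mul f g hm)
  have h1 := hf x hx
  have h2 := hg y hy
  simp only [Finsupp.add_apply, mul_add, Finset.sum_add_distrib]
  omega

lemma pow_le_wtIdeal (w : V → ℕ) (d : ℕ) (I : Ideal (MvPolynomial V K))
    (h : I ≤ wtIdeal K w d) (s : ℕ) : I ^ s ≤ wtIdeal K w (d * s) := by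
  induction s with
  | zero => intro f _ m _; simp
  | succ s ih =>
    rw [pow_succ, Nat.mul_succ]
    exact (Ideal.mul_mono ih h).trans (wtIdeal_mul w _ _)

lemma monomial_mem_pow (G : SimpleGraph V) (n : ℕ) (a : V → ℕ) (h : Pack (triples G) n a) :
    ∏ v, (X v : MvPolynomial V K) ^ a v ∈ pathIdeal3 K G ^ n := by
  induction h with
  | zero a => simp
  | succ T n a b hT _ hb ih =>
    have h1 : ∏ v, (X v : MvPolynomial V K) ^ b v
        = (∏ v, (X v : MvPolynomial V K) ^ a v) * ∏ v ∈ T, X v := by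
      simp only [hb, pow_add, Finset.prod_mul_distrib]
      congr 1
      simp [Finset.prod_ite_mem, apply_ite]
    rw [h1, pow_succ]
    refine Ideal.mul_mem_mul ih ?_
    clear h1
    obtain ⟨u, v, w, h1, h2, h3, rfl⟩ := hT
    refine Ideal.subset_span ⟨u, v, w, h1, h2, h3, ?_⟩
    rw [Finset.prod_insert (by simp [h1.ne, h3]), Finset.prod_pair h2.ne, mul_assoc]

lemma pow_le_symbolic {R : Type*} [CommRing R] (I : Ideal R) (n : ℕ) :
    I ^ n ≤ symbolicPower I n := by
  refine le_iInf₂ fun p hp => Ideal.pow_right_mono hp.1.2 n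

lemma prime_span (C : Set V) :
    (Ideal.span (X '' C) : Ideal (MvPolynomial V K)).IsPrime := by
  classical
  let φ : MvPolynomial V K →ₐ[K] MvPolynomial V K :=
    aeval (fun v => if v ∈ C then 0 else X v)
  have h : (Ideal.span (X '' C) : Ideal (MvPolynomial V K)) = RingHom.ker φ.toRingHom := by
    apply le_antisymm
    · rw [Ideal.span_le]
      rintro _ ⟨v, hv, rfl⟩
      simp [φ, RingHom.mem_ker, hv]
    · intro f hf
      have key : ∀ g : MvPolynomial V K, g - φ g ∈
          (Ideal.span (X '' C) : Ideal (MvPolynomial V K)) := by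
        intro g
        induction g using MvPolynomial.induction_on with
        | C c => simp [φ, MvPolynomial.algebraMap_eq]
        | add p q hp hq =>
          have := Ideal.add_mem _ hp hq
          convert this using 1
          rw [map_add]; ring
        | mul_X p v hp =>
          by_cases hv : v ∈ C
          · have h0 : φ (p * X v) = 0 := by simp [φ, hv]
            rw [h0, sub_zero]
            exact Ideal.mul_mem_left _ _ (Ideal.subset_span ⟨v, hv, rfl⟩)
          · have h0 : φ (p * X v) = φ p * X v := by simp [φ, hv]
            rw [h0, ← sub_mul]
            exact Ideal.mul_mem_right _ _ hp
      have := key f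
      have h0 : φ f = 0 := hf
      rwa [h0, sub_zero] at this
  rw [h]
  exact RingHom.ker_isPrime _

lemma prod_X_eq (m : V →₀ ℕ) : ∏ v, (X v : MvPolynomial V K) ^ m v = monomial m 1 := by
  rw [MvPolynomial.monomial_eq, C_1, one_mul, Finsupp.prod_fintype _ _ (by simp)]

/-- The Mengerian property gives equality of symbolic and ordinary powers. -/
lemma symbolic_eq_of_mfmc (G : SimpleGraph V) (h : MFMC (triples G)) (n : ℕ) :
    symbolicPower (pathIdeal3 K G) n = pathIdeal3 K G ^ n := by
  refine le_antisymm ?_ (pow_le_symbolic _ _)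
  intro f hf
  rw [f.as_sum]
  refine Ideal.sum_mem _ fun m hm => ?_
  have h1 : (monomial m) (coeff m f) = C (coeff m f) * ∏ v, (X v : MvPolynomial V K) ^ m v := by
    rw [prod_X_eq, C_mul_monomial, mul_one]
  rw [h1]
  refine Ideal.mul_mem_left _ _ (monomial_mem_pow G n m (h n m fun C hC => ?_))
  haveI := prime_span (K := K) (C : Set V)
  have hJ : pathIdeal3 K G ≤ Ideal.span (X '' (C : Set V)) := by
    rw [pathIdeal3, Ideal.span_le]
    rintro _ ⟨u, v, w, h1, h2, h3, rfl⟩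
    obtain ⟨x, hx, hxC⟩ := hC {u, v, w} ⟨u, v, w, h1, h2, h3, rfl⟩
    have hX : (X x : MvPolynomial V K) ∈ Ideal.span (X '' (C : Set V)) :=
      Ideal.subset_span ⟨x, hxC, rfl⟩
    simp only [Finset.mem_insert, Finset.mem_singleton] at hx
    rcases hx with rfl | rfl | rfl
    · exact Ideal.mul_mem_right _ _ (Ideal.mul_mem_right _ _ hX)
    · exact Ideal.mul_mem_right _ _ (Ideal.mul_mem_left _ _ hX)
    · exact Ideal.mul_mem_left _ _ hX
  obtain ⟨q, hq, hqC⟩ := Ideal.exists_minimalPrimes_le hJ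
  have hfq : f ∈ q ^ n := by
    have := (iInf₂_le q hq : symbolicPower (pathIdeal3 K G) n ≤ q ^ n)
    exact this hf
  have hfC := Ideal.pow_right_mono hqC n hfq
  have hw : (Ideal.span (X '' (C : Set V)) : Ideal (MvPolynomial V K)) ≤
      wtIdeal K (fun v => if v ∈ C then 1 else 0) 1 := by
    rw [Ideal.span_le]
    rintro _ ⟨v, hv, rfl⟩ m hm
    rw [MvPolynomial.support_X, Finset.mem_singleton] at hm
    subst hm
    have hv' : v ∈ C := hv
    refine le_trans ?_ (Finset.single_le_sum (fun _ _ => Nat.zero_le _) (Finset.mem_univ v))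
    simp [hv']
  have := pow_le_wtIdeal _ _ _ hw n hfC m hm
  simpa [Finset.sum_ite_mem] using this

/-- A certificate for the failure of equality. -/
lemma witness (G : SimpleGraph V)
    (hsym : ∀ n : ℕ, 1 ≤ n → symbolicPower (pathIdeal3 K G) n = pathIdeal3 K G ^ n)
    (a w : V → ℕ) (d s : ℕ) (hs : 1 ≤ s)
    (hw : ∀ u v x, G.Adj u v → G.Adj v x → u ≠ x → d ≤ w u + w v + w x)
    (hp : ∀ S : Finset V, (∀ u v x, G.Adj u v → G.Adj v x → u ≠ x → u ∈ S ∨ v ∈ S ∨ x ∈ S) →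
      s ≤ ∑ v ∈ S, a v) :
    d * s ≤ ∑ v, w v * a v := by
  classical
  have hmem : (∏ v, (X v : MvPolynomial V K) ^ a v) ∈ symbolicPower (pathIdeal3 K G) s := by
    simp only [symbolicPower, Ideal.mem_iInf]
    intro p hpm
    have hprime := hpm.1.1
    have hle := hpm.1.2
    let S : Finset V := Finset.univ.filter fun v => (X v : MvPolynomial V K) ∈ p
    have hS : s ≤ ∑ v ∈ S, a v := by
      refine hp S fun u v x h1 h2 h3 => ?_
      have : (X u * X v * X x : MvPolynomial V K) ∈ p :=
        hle (Ideal.subset_span ⟨u, v, x, h1, h2, h3, rfl⟩)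
      rcases hprime.mem_or_mem this with h | h
      · rcases hprime.mem_or_mem h with h | h
        · left; simpa [S] using h
        · right; left; simpa [S] using h
      · right; right; simpa [S] using h
    rw [← Finset.prod_mul_prod_compl S]
    refine Ideal.mul_mem_right _ _ (Ideal.pow_le_pow_right hS ?_)
    rw [← Finset.prod_pow_eq_pow_sum]
    refine Ideal.prod_mem_prod fun v hv => Ideal.pow_mem_pow ?_ _
    simpa [S] using hv
  rw [hsym s hs] at hmem
  have hJ : pathIdeal3 K G ≤ wtIdeal K w d := by
    rw [pathIdeal3, Ideal.span_le]
    rintro _ ⟨u, v, x, h1, h2, h3, rfl⟩ m hm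
    have : (X u * X v * X x : MvPolynomial V K) =
        monomial (Finsupp.single u 1 + Finsupp.single v 1 + Finsupp.single x 1) 1 := by
      simp [X, monomial_mul]
    rw [this] at hm
    have hm' := Finset.mem_singleton.1 (MvPolynomial.support_monomial_subset hm)
    subst hm'
    have := hw u v x h1 h2 h3
    simpa [mul_add, Finset.sum_add_distrib, Finsupp.single_apply] using this
  have h2 := pow_le_wtIdeal _ _ _ hJ s hmem
  let m : V →₀ ℕ := Finsupp.equivFunOnFinite.symm a
  have h3 : (∏ v, (X v : MvPolynomial V K) ^ a v) = monomial m 1 := by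
    rw [← prod_X_eq]; rfl
  rw [h3] at h2
  have := h2 m (by simp [MvPolynomial.support_monomial])
  simpa [m] using this

end algebra

section combi

variable {V : Type*} [DecidableEq V]

lemma Pack.mono {E E' : Set (Finset V)} (h : E ⊆ E') {n : ℕ} {a : V → ℕ} (hp : Pack E n a) :
    Pack E' n a := by
  induction hp with
  | zero a => exact .zero a
  | succ T n a b hT _ hb ih => exact .succ T n a b (h hT) ih hb

lemma mfmc_of_step (E : Set (Finset V))
    (h : ∀ (n : ℕ) (a : V → ℕ), (∀ C, IsCover E C → n + 1 ≤ ∑ v ∈ C, a v) →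
      Pack E (n + 1) a ∨ ∃ T ∈ E, (∀ v ∈ T, 1 ≤ a v) ∧
        ∀ C, IsCover E C → n ≤ ∑ v ∈ C, (a v - if v ∈ T then 1 else 0)) : MFMC E := by
  intro n
  induction n with
  | zero => intro a _; exact .zero a
  | succ n ih =>
    intro a ha
    rcases h n a ha with h | ⟨T, hT, hpos, hC⟩
    · exact h
    · refine .succ T n _ a hT (ih _ hC) fun v => ?_
      by_cases hv : v ∈ T
      · have := hpos v hv
        simp only [hv, if_true]; omega
      · simp [hv]

/-- Interval hypergraphs with intervals of constant length are Mengerian. -/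
lemma mfmc_interval [Fintype V] (f : V → ℕ) (hf : Function.Injective f) (E : Set (Finset V))
    (hE : ∀ T ∈ E, ∃ i, ∀ v, v ∈ T ↔ i ≤ f v ∧ f v ≤ i + 2) : MFMC E := by
  classical
  refine mfmc_of_step E fun n a ha => Or.inr ?_
  -- a first positive window
  have hex : ∃ i, ∃ T ∈ E, (∀ v, v ∈ T ↔ i ≤ f v ∧ f v ≤ i + 2) ∧ ∀ v ∈ T, 1 ≤ a v := by
    by_contra hno
    push Not at hno
    have := ha (Finset.univ.filter fun v => a v = 0) (by
      intro T hT
      obtain ⟨i, hi⟩ := hE T hT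
      obtain ⟨v, hv, hv0⟩ := hno i T hT hi
      exact ⟨v, hv, by simp; omega⟩)
    have h0 : ∑ v ∈ Finset.univ.filter (fun v => a v = 0), a v = 0 :=
      Finset.sum_eq_zero fun v hv => by simpa using hv
    omega
  obtain ⟨T, hT, hTi, hpos⟩ := Nat.find_spec hex
  have hmin := fun j => @Nat.find_min _ _ hex j
  set i := Nat.find hex
  refine ⟨T, hT, hpos, fun C hC => ?_⟩
  obtain ⟨j, hj, hjmax⟩ := Finset.exists_max_image (T ∩ C) f (by
    obtain ⟨v, h1, h2⟩ := hC T hT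
    exact ⟨v, Finset.mem_inter.2 ⟨h1, h2⟩⟩)
  obtain ⟨hjT, hjC⟩ := Finset.mem_inter.1 hj
  have hji := (hTi j).1 hjT
  let D := C.filter fun v => f j ≤ f v
  let Z := Finset.univ.filter fun v => a v = 0
  have hcov : IsCover E (D ∪ Z) := by
    intro S hS
    obtain ⟨s, hs⟩ := hE S hS
    rcases lt_or_ge s i with hlt | hge
    · have := hmin s hlt
      push Not at this
      obtain ⟨v, hv, hv0⟩ := this S hS hs
      exact ⟨v, hv, by simp [Z]; omega⟩
    · rcases le_or_gt s (f j) with h | h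
      · exact ⟨j, (hs j).2 ⟨h, by omega⟩, by simp [D, hjC]⟩
      · obtain ⟨v, hv, hvC⟩ := hC S hS
        have := (hs v).1 hv
        exact ⟨v, hv, by simp [D, hvC]; omega⟩
  have h1 := ha _ hcov
  have h2 : ∑ v ∈ D ∪ Z, a v ≤ ∑ v ∈ D, a v := by
    rw [← Finset.union_sdiff_self_eq_union, Finset.sum_union Finset.disjoint_sdiff]
    have : ∑ v ∈ Z \ D, a v = 0 := Finset.sum_eq_zero fun v hv => by
      have := (Finset.mem_sdiff.1 hv).1
      simpa [Z] using this
    omega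
  have hjD : j ∈ D := by simp [D, hjC]
  have h3 : ∑ v ∈ D, (a v - if v ∈ T then 1 else 0) ≤
      ∑ v ∈ C, (a v - if v ∈ T then 1 else 0) :=
    Finset.sum_le_sum_of_subset (Finset.filter_subset _ _)
  rw [← Finset.add_sum_erase _ _ hjD] at h2 h3
  have h4 : ∑ v ∈ D.erase j, (a v - if v ∈ T then 1 else 0) = ∑ v ∈ D.erase j, a v := by
    refine Finset.sum_congr rfl fun v hv => ?_
    have hvT : v ∉ T := by
      intro hvT
      simp only [Finset.mem_erase, D, Finset.mem_filter] at hv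
      have := hjmax v (Finset.mem_inter.2 ⟨hvT, hv.2.1⟩)
      exact hv.1 (hf (le_antisymm this hv.2.2))
    simp [hvT]
  rw [h4] at h3
  have := hpos j hjT
  simp only [hjT, if_true] at h3
  omega

lemma mfmc_transport {W : Type*} [DecidableEq W] (e : V ≃ W) (E : Set (Finset V))
    (F : Set (Finset W)) (hEF : ∀ T ∈ E, T.map e.toEmbedding ∈ F)
    (hFE : ∀ T ∈ F, T.map e.symm.toEmbedding ∈ E) (h : MFMC F) : MFMC E := by
  intro n a ha
  have h1 : Pack F n (a ∘ e.symm) := by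
    refine h n _ fun C hC => ?_
    have := ha (C.map e.symm.toEmbedding) (by
      intro T hT
      obtain ⟨v, hv, hvC⟩ := hC _ (hEF T hT)
      obtain ⟨x, hx, rfl⟩ := Finset.mem_map.1 hv
      exact ⟨x, hx, Finset.mem_map.2 ⟨_, hvC, by simp⟩⟩)
    simpa using this
  have h2 : ∀ n b, Pack F n b → Pack E n (b ∘ e) := by
    intro n b hb
    induction hb with
    | zero a => exact .zero _
    | succ T n a b hT _ hb ih =>
      refine .succ _ n _ _ (hFE T hT) ih fun v => ?_
      simp only [Function.comp, hb]
      congr 2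
      simp
  have := h2 n _ h1
  simpa [Function.comp_def] using this

lemma mfmc_iso {W : Type*} [DecidableEq W] (G : SimpleGraph V) (H : SimpleGraph W)
    (e : G ≃g H) (h : MFMC (triples H)) : MFMC (triples G) := by
  refine mfmc_transport e.toEquiv _ _ ?_ ?_ h
  · rintro _ ⟨u, v, w, h1, h2, h3, rfl⟩
    exact ⟨e u, e v, e w, e.map_adj_iff.2 h1, e.map_adj_iff.2 h2, by simpa using h3,
      by simp [Finset.map_insert]⟩
  · rintro _ ⟨u, v, w, h1, h2, h3, rfl⟩
    exact ⟨e.symm u, e.symm v, e.symm w, e.symm.map_adj_iff.2 h1, e.symm.map_adj_iff.2 h2,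
      by simpa using h3, by simp [Finset.map_insert]; rfl⟩

lemma mfmc_path [Fintype V] (m : ℕ) (G : SimpleGraph V) (e : G ≃g pathGraph m) :
    MFMC (triples G) := by
  refine mfmc_interval (fun v => (e v).val) (fun x y h => e.injective (Fin.ext h)) _ ?_
  rintro _ ⟨u, v, w, h1, h2, h3, rfl⟩
  have h1' := pathGraph_adj.1 (e.map_adj_iff.2 h1)
  have h2' := pathGraph_adj.1 (e.map_adj_iff.2 h2)
  have h3' : (e u).val ≠ (e w).val := fun h => h3 (e.injective (Fin.ext h))
  refine ⟨(e v).val - 1, fun x => ?_⟩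
  have key : ∀ y, x = y ↔ (e x).val = (e y).val :=
    fun y => ⟨fun h => by rw [h], fun h => e.injective (Fin.ext h)⟩
  simp only [Finset.mem_insert, Finset.mem_singleton, key]
  omega

/-- Cyclic windows. -/
def cyc (n : ℕ) [NeZero n] : Set (Finset (Fin n)) := {T | ∃ c, T = {c - 1, c, c + 1}}

lemma cover_cyc {n : ℕ} [NeZero n] (C : Finset (Fin n)) :
    IsCover (cyc n) C ↔ ∀ c, c - 1 ∈ C ∨ c ∈ C ∨ c + 1 ∈ C := by
  constructor
  · intro h c
    obtain ⟨v, hv, hvC⟩ := h _ ⟨c, rfl⟩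
    simp only [Finset.mem_insert, Finset.mem_singleton] at hv
    rcases hv with rfl | rfl | rfl <;> simp [hvC]
  · rintro h _ ⟨c, rfl⟩
    rcases h c with h | h | h
    · exact ⟨_, by simp, h⟩
    · exact ⟨_, by simp, h⟩
    · exact ⟨_, by simp, h⟩

lemma triples_cycle (n : ℕ) : triples (cycleGraph (n + 3)) = cyc (n + 3) := by
  have h2 : (1 : Fin (n + 3)) + 1 ≠ 0 := by
    intro h
    have := congrArg Fin.val h
    simp [Fin.val_add] at this
    rw [Nat.mod_eq_of_lt (by omega)] at this
    omega
  ext T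
  constructor
  · rintro ⟨u, v, w, h1, h2, h3, rfl⟩
    rw [cycleGraph_adj] at h1 h2
    refine ⟨v, ?_⟩
    rcases h1 with h1 | h1 <;> rcases h2 with h2 | h2
    · obtain rfl : u = v + 1 := by rw [← h1]; abel
      obtain rfl : w = v - 1 := by rw [← h2]; abel
      ext x; simp; tauto
    · exact absurd (sub_left_injective (h1.trans h2.symm)) h3
    · exact absurd (sub_right_injective (h1.trans h2.symm)) h3
    · obtain rfl : u = v - 1 := by rw [← h1]; abel
      obtain rfl : w = v + 1 := by rw [← h2]; abel
      rfl
  · rintro ⟨c, rfl⟩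
    refine ⟨c - 1, c, c + 1, ?_, ?_, ?_, rfl⟩
    · rw [cycleGraph_adj]; right; abel
    · rw [cycleGraph_adj]; right; abel
    · intro h
      apply h2
      have : c + 1 - (c - 1) = 0 := by rw [h]; abel
      rw [← this]; abel

/-- If a cyclic window hypergraph has a vertex of weight zero, it behaves like a path. -/
lemma pack_of_zero (m n : ℕ) (a : Fin (m + 3) → ℕ) (z : Fin (m + 3)) (hz : a z = 0)
    (ha : ∀ C, IsCover (cyc (m + 3)) C → n ≤ ∑ v ∈ C, a v) : Pack (cyc (m + 3)) n a := by
  let E : Set (Finset (Fin (m + 3))) := {T | T ∈ cyc (m + 3) ∧ z ∉ T}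
  have hE : MFMC E := by
    refine mfmc_interval (fun v => (v - z).val)
      (fun x y h => sub_left_injective (Fin.ext h)) E ?_
    rintro _ ⟨⟨c, rfl⟩, hzc⟩
    obtain ⟨d, rfl⟩ : ∃ d, c = d + z := ⟨c - z, by abel⟩
    refine ⟨d.val - 1, fun v => ?_⟩
    obtain ⟨x, rfl⟩ : ∃ x, v = x + z := ⟨v - z, by abel⟩
    have e1 : ∀ y : Fin (m + 3), d + z - 1 = y + z ↔ d - 1 = y := fun y => by
      rw [add_sub_right_comm]; exact add_left_inj _
    have e2 : ∀ y : Fin (m + 3), d + z + 1 = y + z ↔ d + 1 = y := fun y => by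
      rw [add_right_comm]; exact add_left_inj _
    have hz0 : z = 0 + z := by simp
    simp only [Finset.mem_insert, Finset.mem_singleton, not_or] at hzc
    obtain ⟨z1, z2, z3⟩ := hzc
    have z1' : d - 1 ≠ 0 := fun h => z1 (by rw [add_sub_right_comm, h, zero_add])
    have z2' : d ≠ 0 := fun h => z2 (by rw [h, zero_add])
    have z3' : d + 1 ≠ 0 := fun h => z3 (by rw [add_right_comm, h, zero_add])
    simp only [Finset.mem_insert, Finset.mem_singleton, add_sub_cancel_right]
    rw [eq_comm, e1, add_left_inj, eq_comm (a := x + z) (b := d + z + 1), e2]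
    have v1 : (d - 1).val = d.val - 1 := by
      rw [Fin.val_sub_one_of_ne_zero z2']
    have v0 : d.val ≠ 0 := fun h => z2' (Fin.ext h)
    have v2 : (d + 1).val = d.val + 1 := by
      rw [Fin.val_add_one_of_lt']
      have := d.isLt
      by_contra hcon
      apply z3'
      apply Fin.ext
      have : d.val = m + 2 := by omega
      simp [Fin.val_add, this]
    rw [Fin.ext_iff, Fin.ext_iff, Fin.ext_iff, v1, v2]
    omega
  refine Pack.mono (fun T hT => hT.1) (hE n a fun C hC => ?_)
  have := ha (insert z C) (by
    intro T hT
    by_cases h : z ∈ T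
    · exact ⟨z, h, by simp⟩
    · obtain ⟨v, hv, hvC⟩ := hC T ⟨hT, h⟩
      exact ⟨v, hv, by simp [hvC]⟩)
  by_cases hzC : z ∈ C
  · rwa [Finset.insert_eq_of_mem hzC] at this
  · rwa [Finset.sum_insert hzC, hz, zero_add] at this

end combi

section small

lemma mfmc_cyc3 : MFMC (cyc 3) := by
  refine mfmc_of_step _ fun n a ha => ?_
  by_cases hz : ∃ z, a z = 0
  · obtain ⟨z, hz⟩ := hz
    exact Or.inl (pack_of_zero 0 (n + 1) a z hz ha)
  push Not at hz
  right
  have h0 := ha {0} ((cover_cyc _).2 (by decide))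
  have h1 := ha {1} ((cover_cyc _).2 (by decide))
  have h2 := ha {2} ((cover_cyc _).2 (by decide))
  simp only [Finset.sum_singleton] at h0 h1 h2
  refine ⟨{0, 1, 2}, ⟨1, by decide⟩, fun v _ => Nat.one_le_iff_ne_zero.2 (hz v), fun C hC => ?_⟩
  rw [cover_cyc] at hC
  have hsub : ∀ C : Finset (Fin 3), (∀ c, c - 1 ∈ C ∨ c ∈ C ∨ c + 1 ∈ C) →
      {0} ⊆ C ∨ {1} ⊆ C ∨ {2} ⊆ C := by decide
  rcases hsub C hC with h | h | h <;>
  · refine le_trans ?_ (Finset.sum_le_sum_of_subset h)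
    simp
    omega

lemma mfmc_cyc6 : MFMC (cyc 6) := by
  refine mfmc_of_step _ fun n a ha => ?_
  by_cases hz : ∃ z, a z = 0
  · obtain ⟨z, hz⟩ := hz
    exact Or.inl (pack_of_zero 3 (n + 1) a z hz ha)
  push Not at hz
  right
  have hpos : ∀ v, 1 ≤ a v := fun v => Nat.one_le_iff_ne_zero.2 (hz v)
  have p0 := hpos 0
  have p1 := hpos 1
  have p2 := hpos 2
  have p3 := hpos 3
  have p4 := hpos 4
  have p5 := hpos 5
  have h0 := ha {0, 3} ((cover_cyc _).2 (by decide))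
  have h1 := ha {1, 4} ((cover_cyc _).2 (by decide))
  have h2 := ha {2, 5} ((cover_cyc _).2 (by decide))
  have h3 := ha {0, 2, 4} ((cover_cyc _).2 (by decide))
  have h4 := ha {1, 3, 5} ((cover_cyc _).2 (by decide))
  simp +decide only [Finset.sum_insert, Finset.sum_singleton, Finset.mem_insert,
    Finset.mem_singleton, not_false_eq_true] at h0 h1 h2 h3 h4
  have hsub : ∀ C : Finset (Fin 6), (∀ c, c - 1 ∈ C ∨ c ∈ C ∨ c + 1 ∈ C) →
      {0, 3} ⊆ C ∨ {1, 4} ⊆ C ∨ {2, 5} ⊆ C ∨ {0, 2, 4} ⊆ C ∨ {1, 3, 5} ⊆ C := by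
    decide +kernel
  by_cases hA : n + 2 ≤ a 0 + (a 2 + a 4)
  · refine ⟨{0, 1, 2}, ⟨1, by decide⟩, fun v _ => hpos v, fun C hC => ?_⟩
    rcases hsub C ((cover_cyc C).1 hC) with h | h | h | h | h <;>
    · refine le_trans ?_ (Finset.sum_le_sum_of_subset h)
      simp +decide only [Finset.sum_insert, Finset.sum_singleton, Finset.mem_insert,
        Finset.mem_singleton, not_false_eq_true, if_true, if_false]
      omega
  · refine ⟨{1, 2, 3}, ⟨2, by decide⟩, fun v _ => hpos v, fun C hC => ?_⟩
    rcases hsub C ((cover_cyc C).1 hC) with h | h | h | h | h <;>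
    · refine le_trans ?_ (Finset.sum_le_sum_of_subset h)
      simp +decide only [Finset.sum_insert, Finset.sum_singleton, Finset.mem_insert,
        Finset.mem_singleton, not_false_eq_true, if_true, if_false]
      omega

/-- The minimal covers of the cyclic windows on nine vertices. -/
def covers9 : List (Finset (Fin 9)) :=
  [{0, 3, 6}, {1, 4, 7}, {2, 5, 8}, {0, 1, 4, 6},
   {0, 2, 4, 6}, {0, 2, 4, 7}, {0, 2, 5, 6}, {0, 2, 5, 7},
   {0, 3, 4, 7}, {0, 3, 5, 7}, {0, 3, 5, 8}, {1, 2, 5, 7},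
   {1, 3, 5, 7}, {1, 3, 5, 8}, {1, 3, 6, 7}, {1, 3, 6, 8},
   {1, 4, 5, 8}, {1, 4, 6, 8}, {2, 3, 6, 8}, {2, 4, 6, 8},
   {2, 4, 7, 8}]

lemma covers9_sub : ∀ C : Finset (Fin 9), (∀ c, c - 1 ∈ C ∨ c ∈ C ∨ c + 1 ∈ C) →
    ∃ D ∈ covers9, D ⊆ C := by
  decide +kernel

lemma covers9_cover : ∀ D ∈ covers9, ∀ c, c - 1 ∈ D ∨ c ∈ D ∨ c + 1 ∈ D := by
  decide +kernel

/-- If a window is not blocked, it can be subtracted. -/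
lemma step9 (n : ℕ) (a : Fin 9 → ℕ) (hpos : ∀ v, 1 ≤ a v) (T : Finset (Fin 9))
    (h1 : ∀ D ∈ covers9, n + (D.filter (· ∈ T)).card ≤ ∑ v ∈ D, a v) :
    ∀ C, IsCover (cyc 9) C → n ≤ ∑ v ∈ C, (a v - if v ∈ T then 1 else 0) := by
  intro C hC
  obtain ⟨D, hD, hDC⟩ := covers9_sub C ((cover_cyc C).1 hC)
  refine le_trans ?_ (Finset.sum_le_sum_of_subset hDC)
  have h2 := h1 D hD
  have h3 : ∑ v ∈ D, a v = ∑ v ∈ D, (a v - if v ∈ T then 1 else 0) +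
      (D.filter (· ∈ T)).card := by
    rw [Finset.card_filter, ← Finset.sum_add_distrib]
    refine Finset.sum_congr rfl fun v _ => ?_
    have := hpos v
    split_ifs <;> omega
  omega

lemma arith9 (n a0 a1 a2 a3 a4 a5 a6 a7 a8 : ℕ)
    (p0 : 1 ≤ a0) (p1 : 1 ≤ a1) (p2 : 1 ≤ a2) (p3 : 1 ≤ a3) (p4 : 1 ≤ a4) (p5 : 1 ≤ a5)
    (p6 : 1 ≤ a6) (p7 : 1 ≤ a7) (p8 : 1 ≤ a8)
    (h0 : n + 1 ≤ a0 + a3 + a6)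
    (h1 : n + 1 ≤ a1 + a4 + a7)
    (h2 : n + 1 ≤ a2 + a5 + a8)
    (h3 : n + 1 ≤ a0 + a1 + a4 + a6)
    (h4 : n + 1 ≤ a0 + a2 + a4 + a6)
    (h5 : n + 1 ≤ a0 + a2 + a4 + a7)
    (h6 : n + 1 ≤ a0 + a2 + a5 + a6)
    (h7 : n + 1 ≤ a0 + a2 + a5 + a7)
    (h8 : n + 1 ≤ a0 + a3 + a4 + a7)
    (h9 : n + 1 ≤ a0 + a3 + a5 + a7)
    (h10 : n + 1 ≤ a0 + a3 + a5 + a8)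
    (h11 : n + 1 ≤ a1 + a2 + a5 + a7)
    (h12 : n + 1 ≤ a1 + a3 + a5 + a7)
    (h13 : n + 1 ≤ a1 + a3 + a5 + a8)
    (h14 : n + 1 ≤ a1 + a3 + a6 + a7)
    (h15 : n + 1 ≤ a1 + a3 + a6 + a8)
    (h16 : n + 1 ≤ a1 + a4 + a5 + a8)
    (h17 : n + 1 ≤ a1 + a4 + a6 + a8)
    (h18 : n + 1 ≤ a2 + a3 + a6 + a8)
    (h19 : n + 1 ≤ a2 + a4 + a6 + a8)
    (h20 : n + 1 ≤ a2 + a4 + a7 + a8) :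
    (n + 2 ≤ a0 + a1 + a4 + a6 ∧ n + 2 ≤ a0 + a3 + a5 + a8 ∧ n + 2 ≤ a1 + a3 + a5 + a8 ∧ n + 2 ≤ a1 + a3 + a6 + a8 ∧ n + 2 ≤ a1 + a4 + a5 + a8 ∧ n + 2 ≤ a1 + a4 + a6 + a8) ∨
    (n + 2 ≤ a0 + a1 + a4 + a6 ∧ n + 2 ≤ a0 + a2 + a4 + a6 ∧ n + 2 ≤ a0 + a2 + a4 + a7 ∧ n + 2 ≤ a0 + a2 + a5 + a6 ∧ n + 2 ≤ a0 + a2 + a5 + a7 ∧ n + 2 ≤ a1 + a2 + a5 + a7) ∨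
    (n + 2 ≤ a1 + a2 + a5 + a7 ∧ n + 2 ≤ a1 + a3 + a5 + a7 ∧ n + 2 ≤ a1 + a3 + a5 + a8 ∧ n + 2 ≤ a1 + a3 + a6 + a7 ∧ n + 2 ≤ a1 + a3 + a6 + a8 ∧ n + 2 ≤ a2 + a3 + a6 + a8) := by
  by_contra hcon
  simp only [not_or] at hcon
  obtain ⟨g0, g1, g2⟩ := hcon
  simp only [not_and_or, not_le] at g0 g1 g2
  rcases g0 with g0 | g0 | g0 | g0 | g0 | g0 <;>
  rcases g1 with g1 | g1 | g1 | g1 | g1 | g1 <;>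
  omega

lemma mfmc_cyc9 : MFMC (cyc 9) := by
  refine mfmc_of_step _ fun n a ha => ?_
  by_cases hz : ∃ z, a z = 0
  · obtain ⟨z, hz⟩ := hz
    exact Or.inl (pack_of_zero 6 (n + 1) a z hz ha)
  push Not at hz
  right
  have hpos : ∀ v, 1 ≤ a v := fun v => Nat.one_le_iff_ne_zero.2 (hz v)
  have hall : ∀ D ∈ covers9, n + 1 ≤ ∑ v ∈ D, a v :=
    fun D hD => ha D ((cover_cyc D).2 (covers9_cover D hD))
  have hall' := hall
  simp +decide only [covers9, List.forall_mem_cons, Finset.sum_insert, Finset.sum_singleton,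
    Finset.mem_insert, Finset.mem_singleton, not_false_eq_true] at hall
  obtain ⟨h0, h1, h2, h3, h4, h5, h6, h7, h8, h9, h10, h11, h12, h13, h14, h15, h16, h17, h18, h19, h20, -⟩ := hall
  simp only [← add_assoc] at h0 h1 h2 h3 h4 h5 h6 h7 h8 h9 h10 h11 h12 h13 h14 h15 h16 h17 h18 h19 h20
  have key := arith9 n (a 0) (a 1) (a 2) (a 3) (a 4) (a 5) (a 6) (a 7) (a 8)
    (hpos 0) (hpos 1) (hpos 2) (hpos 3) (hpos 4) (hpos 5) (hpos 6) (hpos 7) (hpos 8)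
    h0 h1 h2 h3 h4 h5 h6 h7 h8 h9 h10 h11 h12 h13 h14 h15 h16 h17 h18 h19 h20
  have hsplit : ∀ T : Finset (Fin 9), (∀ D ∈ covers9, (D.filter (· ∈ T)).card ≤ 2) →
      (∀ D ∈ covers9.filter (fun D => 2 ≤ (D.filter (· ∈ T)).card), n + 2 ≤ ∑ v ∈ D, a v) →
      ∀ D ∈ covers9, n + (D.filter (· ∈ T)).card ≤ ∑ v ∈ D, a v := by
    intro T hT h D hD
    by_cases h2 : 2 ≤ (D.filter (· ∈ T)).card
    · have := h D (List.mem_filter.2 ⟨hD, by simpa using h2⟩)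
      have := hT D hD
      omega
    · have := hall' D hD
      omega
  rcases key with key | key | key
  · refine ⟨{8, 0, 1}, ⟨0, by decide⟩, fun v _ => hpos v, step9 n a hpos _ (hsplit _ ?_ ?_)⟩
    · decide +kernel
    · have hL : covers9.filter (fun D => 2 ≤ (D.filter (· ∈ ({8, 0, 1} : Finset (Fin 9)))).card) =
          [{0, 1, 4, 6}, {0, 3, 5, 8}, {1, 3, 5, 8}, {1, 3, 6, 8}, {1, 4, 5, 8}, {1, 4, 6, 8}] := by
        decide +kernel
      rw [hL]
      simp +decide only [List.forall_mem_cons, Finset.sum_insert, Finset.sum_singleton,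
        Finset.mem_insert, Finset.mem_singleton, not_false_eq_true, ← add_assoc]
      simpa using key
  · refine ⟨{0, 1, 2}, ⟨1, by decide⟩, fun v _ => hpos v, step9 n a hpos _ (hsplit _ ?_ ?_)⟩
    · decide +kernel
    · have hL : covers9.filter (fun D => 2 ≤ (D.filter (· ∈ ({0, 1, 2} : Finset (Fin 9)))).card) =
          [{0, 1, 4, 6}, {0, 2, 4, 6}, {0, 2, 4, 7}, {0, 2, 5, 6}, {0, 2, 5, 7}, {1, 2, 5, 7}] := by
        decide +kernel
      rw [hL]
      simp +decide only [List.forall_mem_cons, Finset.sum_insert, Finset.sum_singleton,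
        Finset.mem_insert, Finset.mem_singleton, not_false_eq_true, ← add_assoc]
      simpa using key
  · refine ⟨{1, 2, 3}, ⟨2, by decide⟩, fun v _ => hpos v, step9 n a hpos _ (hsplit _ ?_ ?_)⟩
    · decide +kernel
    · have hL : covers9.filter (fun D => 2 ≤ (D.filter (· ∈ ({1, 2, 3} : Finset (Fin 9)))).card) =
          [{1, 2, 5, 7}, {1, 3, 5, 7}, {1, 3, 5, 8}, {1, 3, 6, 7}, {1, 3, 6, 8}, {2, 3, 6, 8}] := by
        decide +kernel
      rw [hL]
      simp +decide only [List.forall_mem_cons, Finset.sum_insert, Finset.sum_singleton,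
        Finset.mem_insert, Finset.mem_singleton, not_false_eq_true, ← add_assoc]
      simpa using key

end small

section forward

variable {V : Type*} [Fintype V] [DecidableEq V] {K : Type*} [Field K]

lemma no_claw (G : SimpleGraph V)
    (hsym : ∀ n : ℕ, 1 ≤ n → symbolicPower (pathIdeal3 K G) n = pathIdeal3 K G ^ n)
    (v a b c : V) (ha : G.Adj v a) (hb : G.Adj v b) (hc : G.Adj v c)
    (hab : a ≠ b) (hac : a ≠ c) (hbc : b ≠ c) : False := by
  have := witness G hsym
    (fun x => (if x = v then 2 else 0) + (if x = a then 1 else 0) + (if x = b then 1 else 0)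
      + (if x = c then 1 else 0)) (fun _ => 1) 3 2 (by norm_num) (by intros; norm_num) (by
      intro S hS
      have h1 := hS a v b ha.symm hb hab
      have h2 := hS a v c ha.symm hc hac
      have h3 := hS b v c hb.symm hc hbc
      simp only [Finset.sum_add_distrib, Finset.sum_ite_eq']
      split_ifs <;> simp_all)
  simp [Finset.sum_add_distrib] at this

lemma classify (G : SimpleGraph V) (hconn : G.Connected)
    (hclaw : ∀ v a b c, G.Adj v a → G.Adj v b → G.Adj v c → a ≠ b → a ≠ c → b ≠ c → False) :
    (∃ m : ℕ, 1 ≤ m ∧ Nonempty (G ≃g pathGraph m)) ∨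
      ∃ n : ℕ, Nonempty (G ≃g cycleGraph (n + 3)) := by
  classical
  let P : ℕ → Prop := fun m => 1 ≤ m ∧ ∃ f : ℕ → V,
    (∀ i j, i < m → j < m → f i = f j → i = j) ∧ ∀ i, i + 1 < m → G.Adj (f i) (f (i + 1))
  have hbound : ∀ m, P m → m ≤ Fintype.card V := by
    rintro m ⟨-, f, hf, -⟩
    have := Fintype.card_le_of_injective (fun i : Fin m => f i)
      (fun i j h => Fin.ext (hf i j i.2 j.2 h))
    simpa using this
  have hex : ∃ m, P m := by
    obtain ⟨x⟩ := hconn.nonempty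
    exact ⟨1, le_refl _, fun _ => x, fun i j hi hj _ => by omega, fun i hi => by omega⟩
  obtain ⟨m, hm, hmax⟩ : ∃ m, P m ∧ ∀ k, P k → k ≤ m := by
    obtain ⟨m0, h0⟩ := hex
    refine ⟨Nat.findGreatest P (Fintype.card V), Nat.findGreatest_spec (hbound _ h0) h0, ?_⟩
    intro k hk
    exact Nat.le_findGreatest (hbound k hk) hk
  obtain ⟨hm1, f, hf, hadj⟩ := hm
  have hadj' : ∀ i, 1 ≤ i → i < m → G.Adj (f i) (f (i - 1)) := by
    intro i h1 h2
    have := hadj (i - 1) (by omega)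
    rw [Nat.sub_add_cancel h1] at this
    exact this.symm
  have hne : ∀ i j, i < m → j < m → i ≠ j → f i ≠ f j :=
    fun i j hi hj hij h => hij (hf i j hi hj h)
  have hsurj : ∀ x, ∃ i, i < m ∧ f i = x := by
    by_contra hcon
    push Not at hcon
    obtain ⟨x, hx⟩ := hcon
    let R : Set V := {y | ∃ i, i < m ∧ f i = y}
    obtain ⟨p⟩ := hconn.preconnected (f 0) x
    obtain ⟨d, -, ⟨i, hi, hiy⟩, hz⟩ := p.exists_boundary_dart R ⟨0, hm1, rfl⟩
      (by rintro ⟨i, hi, h⟩; exact hx i hi h)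
    have hdz : G.Adj (f i) d.snd := by rw [hiy]; exact d.adj
    have hzf : ∀ j, j < m → f j ≠ d.snd := fun j hj h => hz ⟨j, hj, h⟩
    by_cases h0 : i = 0
    · have : P (m + 1) := by
        refine ⟨by omega, fun k => if k = 0 then d.snd else f (k - 1), ?_, ?_⟩
        · intro k l hk hl hkl
          by_cases hk0 : k = 0 <;> by_cases hl0 : l = 0 <;> simp only [hk0, hl0, if_true, if_false] at hkl
          · omega
          · exact absurd hkl.symm (hzf _ (by omega))
          · exact absurd hkl (hzf _ (by omega))
          · have := hf _ _ (by omega) (by omega) hkl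
            omega
        · intro k hk
          by_cases hk0 : k = 0
          · subst hk0; subst h0
            simpa using hdz.symm
          · have := hadj (k - 1) (by omega)
            rw [Nat.sub_add_cancel (by omega)] at this
            simpa [hk0] using this
      have := hmax _ this
      omega
    · by_cases hl : i = m - 1
      · have : P (m + 1) := by
          refine ⟨by omega, fun k => if k = m then d.snd else f k, ?_, ?_⟩
          · intro k l hk hl hkl
            by_cases hk0 : k = m <;> by_cases hl0 : l = m <;> simp only [hk0, hl0, if_true, if_false] at hkl
            · omega
            · exact absurd hkl.symm (hzf _ (by omega))
            · exact absurd hkl (hzf _ (by omega))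
            · exact hf _ _ (by omega) (by omega) hkl
          · intro k hk
            have hkm : k ≠ m := by omega
            by_cases hk0 : k + 1 = m
            · have : k = i := by omega
              subst this
              simpa [hk0, hkm] using hdz
            · simpa [hk0, hkm] using hadj k (by omega)
        have := hmax _ this
        omega
      · exact hclaw (f i) (f (i - 1)) (f (i + 1)) d.snd (hadj' i (by omega) hi)
          (hadj i (by omega)) hdz (hne _ _ (by omega) (by omega) (by omega))
          (hzf _ (by omega)) (hzf _ (by omega))
  have hchord : ∀ i j, i < j → j < m → G.Adj (f i) (f j) → j = i + 1 ∨ (i = 0 ∧ j = m - 1) := by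
    intro i j hij hj h
    by_contra hcon
    by_cases hi0 : i = 0
    · exact hclaw (f j) (f (j - 1)) (f (j + 1)) (f i) (hadj' j (by omega) hj) (hadj j (by omega))
        h.symm (hne _ _ (by omega) (by omega) (by omega)) (hne _ _ (by omega) (by omega) (by omega))
        (hne _ _ (by omega) (by omega) (by omega))
    · exact hclaw (f i) (f (i - 1)) (f (i + 1)) (f j) (hadj' i (by omega) (by omega))
        (hadj i (by omega))
        h (hne _ _ (by omega) (by omega) (by omega)) (hne _ _ (by omega) (by omega) (by omega))
        (hne _ _ (by omega) (by omega) (by omega))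
  let e : Fin m ≃ V := Equiv.ofBijective (fun i : Fin m => f i)
    ⟨fun i j h => Fin.ext (hf i j i.2 j.2 h), fun x => by
      obtain ⟨i, hi, h⟩ := hsurj x
      exact ⟨⟨i, hi⟩, h⟩⟩
  have he : ∀ i : Fin m, e i = f i := fun i => rfl
  by_cases hcyc : 3 ≤ m ∧ G.Adj (f 0) (f (m - 1))
  · right
    obtain ⟨n, rfl⟩ : ∃ n, m = n + 3 := ⟨m - 3, by omega⟩
    refine ⟨n, ⟨RelIso.symm ⟨e, ?_⟩⟩⟩
    have hlt : ∀ i j : Fin (n + 3), i < j →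
        (G.Adj (e i) (e j) ↔ (cycleGraph (n + 3)).Adj i j) := by
      intro i j hij
      have h1 : (j - i).val = j.val - i.val := Fin.sub_val_of_le hij.le
      have h2 : (i - j).val = n + 3 + i.val - j.val := Fin.coe_sub_iff_lt.2 hij
      rw [cycleGraph_adj', he, he, h1, h2]
      have hij' : i.val < j.val := hij
      have := j.isLt
      constructor
      · intro h
        have := hchord i j hij j.2 h
        omega
      · intro h
        have : j.val = i.val + 1 ∨ (i.val = 0 ∧ j.val = n + 2) := by omega
        rcases this with h | ⟨h, h'⟩
        · rw [h]; exact hadj i (by omega)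
        · rw [h, h']; exact hcyc.2
    intro i j
    rcases lt_trichotomy i j with h | h | h
    · exact hlt i j h
    · subst h; simp
    · exact (G.adj_comm _ _).trans ((hlt j i h).trans (SimpleGraph.adj_comm _ _ _))
  · left
    refine ⟨m, hm1, ⟨RelIso.symm ⟨e, ?_⟩⟩⟩
    have hlt : ∀ i j : Fin m, i < j →
        (G.Adj (e i) (e j) ↔ (pathGraph m).Adj i j) := by
      intro i j hij
      have hij' : i.val < j.val := hij
      have := j.isLt
      rw [pathGraph_adj, he, he]
      constructor
      · intro h
        rcases hchord i j hij j.2 h with h' | ⟨h', h''⟩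
        · omega
        · rw [h', h''] at h
          by_contra hcon
          exact hcyc ⟨by omega, h⟩
      · intro h
        have : j.val = i.val + 1 := by omega
        rw [this]; exact hadj i (by omega)
    intro i j
    rcases lt_trichotomy i j with h | h | h
    · exact hlt i j h
    · subst h; simp
    · exact (G.adj_comm _ _).trans ((hlt j i h).trans (SimpleGraph.adj_comm _ _ _))

lemma cycle_adj_cases {n : ℕ} {u v x : Fin (n + 3)} (h1 : (cycleGraph (n + 3)).Adj u v)
    (h2 : (cycleGraph (n + 3)).Adj v x) (h3 : u ≠ x) :
    (v = u + 1 ∧ x = u + 1 + 1) ∨ (v = x + 1 ∧ u = x + 1 + 1) := by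
  rw [cycleGraph_adj] at h1 h2
  rcases h1 with h1 | h1 <;> rcases h2 with h2 | h2
  · right
    obtain rfl : v = x + 1 := by rw [← h2]; abel
    exact ⟨rfl, (sub_eq_iff_eq_add.1 h1).trans (add_comm _ _)⟩
  · exact absurd (sub_left_injective (h1.trans h2.symm)) h3
  · exact absurd (sub_right_injective (h1.trans h2.symm)) h3
  · left
    obtain rfl : v = u + 1 := by rw [← h1]; abel
    exact ⟨rfl, (sub_eq_iff_eq_add.1 h2).trans (add_comm _ _)⟩

lemma cycle_witness (G : SimpleGraph V)
    (hsym : ∀ n : ℕ, 1 ≤ n → symbolicPower (pathIdeal3 K G) n = pathIdeal3 K G ^ n)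
    (n : ℕ) (e : G ≃g cycleGraph (n + 3)) (a w : Fin (n + 3) → ℕ) (d s : ℕ) (hs : 1 ≤ s)
    (hw : ∀ i, d ≤ w i + w (i + 1) + w (i + 1 + 1))
    (hp : ∀ c : Fin (n + 3) → ℕ, (∀ i, 1 ≤ c i + c (i + 1) + c (i + 1 + 1)) →
      s ≤ ∑ i, c i * a i) :
    d * s ≤ ∑ i, w i * a i := by
  have := witness G hsym (fun v => a (e v)) (fun v => w (e v)) d s hs (by
    intro u v x h1 h2 h3
    rcases cycle_adj_cases (e.map_adj_iff.2 h1) (e.map_adj_iff.2 h2) (by simpa using h3)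
      with ⟨h4, h5⟩ | ⟨h4, h5⟩
    · rw [h4, h5]; exact hw _
    · rw [h4, h5]; have := hw (e x); omega) (by
    intro S hS
    have h := hp (fun i => if e.symm i ∈ S then 1 else 0) (by
      intro i
      have adj : ∀ j, G.Adj (e.symm j) (e.symm (j + 1)) := fun j => by
        rw [e.symm.map_adj_iff, cycleGraph_adj]; right; abel
      have := hS (e.symm i) (e.symm (i + 1)) (e.symm (i + 1 + 1)) (adj _) (adj _) (by
        intro h
        have h := e.symm.injective h
        rw [add_assoc] at h
        have h := congrArg Fin.val (left_eq_add.1 h)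
        simp [Fin.val_add] at h
        rw [Nat.mod_eq_of_lt (by omega)] at h
        omega)
      rcases this with h | h | h <;> simp only [h, if_true] <;> omega)
    rw [← Equiv.sum_comp e.toEquiv] at h
    simpa [Finset.sum_ite_mem] using h)
  rw [← Equiv.sum_comp e.toEquiv]
  exact this

/-- The weight for long cycles: it vanishes at `0, 4, 8` and at multiples of three from `12`. -/
def om (x : ℕ) : ℕ :=
  if x < 12 then (if x % 4 = 0 then 0 else 1) else (if x % 3 = 0 then 0 else 1)

lemma om_window (x : ℕ) : 2 ≤ om x + om (x + 1) + om (x + 1 + 1) := by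
  have h : ∀ y, om y = 0 ∧ (y < 12 ∧ y % 4 = 0 ∨ 12 ≤ y ∧ y % 3 = 0) ∨
      om y = 1 ∧ ¬ (y < 12 ∧ y % 4 = 0 ∨ 12 ≤ y ∧ y % 3 = 0) := by
    intro y
    unfold om
    split_ifs <;> omega
  have h0 := h x
  have h1 := h (x + 1)
  have h2 := h (x + 1 + 1)
  omega

lemma sum_om (j : ℕ) : ∑ x ∈ Finset.range (12 + 3 * j), om x = 9 + 2 * j := by
  induction j with
  | zero => decide
  | succ j ih =>
    rw [show 12 + 3 * (j + 1) = 12 + 3 * j + 1 + 1 + 1 by ring, Finset.sum_range_succ,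
      Finset.sum_range_succ, Finset.sum_range_succ, ih]
    have h1 : om (12 + 3 * j) = 0 := by simp [om]
    have h2 : om (12 + 3 * j + 1) = 1 := by
      unfold om; rw [if_neg (by omega), if_neg (by omega)]
    have h3 : om (12 + 3 * j + 2) = 1 := by
      unfold om; rw [if_neg (by omega), if_neg (by omega)]
    omega

lemma cover_om (j : ℕ) (c : ℕ → ℕ) (hc : ∀ x, x + 2 ≤ 12 + 3 * j → 1 ≤ c x + c (x + 1) + c (x + 2))
    (hz : ∀ x, x ≤ 12 + 3 * j → om x = 0 → c x = 0) :
    ∀ t, t ≤ j → 8 + 2 * t + c 1 + c (11 + 3 * t) ≤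
      2 * ∑ x ∈ Finset.range (12 + 3 * t), c x * om x := by
  intro t
  induction t with
  | zero =>
    intro _
    have z0 := hz 0 (by omega) (by decide)
    have z4 := hz 4 (by omega) (by decide)
    have z8 := hz 8 (by omega) (by decide)
    have z12 := hz 12 (by omega) (by decide)
    have w10 := hc 10 (by omega)
    have w0 := hc 0 (by omega)
    have w2 := hc 2 (by omega)
    have w3 := hc 3 (by omega)
    have w4 := hc 4 (by omega)
    have w6 := hc 6 (by omega)
    have w7 := hc 7 (by omega)
    have w8 := hc 8 (by omega)
    have w9 := hc 9 (by omega)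
    simp [Finset.sum_range_succ, om]
    norm_num at w0 w2 w3 w4 w6 w7 w8 w9 w10
    have w1 := hc 1 (by omega)
    have w5 := hc 5 (by omega)
    norm_num at w1 w5
    omega
  | succ t ih =>
    intro ht
    have ih := ih (by omega)
    rw [show 12 + 3 * (t + 1) = 12 + 3 * t + 1 + 1 + 1 by ring, Finset.sum_range_succ,
      Finset.sum_range_succ, Finset.sum_range_succ]
    have h1 : om (12 + 3 * t) = 0 := by simp [om]
    have h2 : om (12 + 3 * t + 1) = 1 := by
      unfold om; rw [if_neg (by omega), if_neg (by omega)]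
    have h3 : om (12 + 3 * t + 2) = 1 := by
      unfold om; rw [if_neg (by omega), if_neg (by omega)]
    have z := hz (12 + 3 * t) (by omega) h1
    have w1 := hc (11 + 3 * t) (by omega)
    have w2 := hc (12 + 3 * t) (by omega)
    have w3 := hc (12 + 3 * t + 1) (by omega)
    have z3 := hz (12 + 3 * t + 3) (by omega) (by
      unfold om; rw [if_neg (by omega), if_pos (by omega)])
    rw [h1, h2, h3]
    rw [show 11 + 3 * t + 1 = 12 + 3 * t by ring, show 11 + 3 * t + 2 = 12 + 3 * t + 1 by ring] at w1
    rw [show 11 + 3 * (t + 1) = 12 + 3 * t + 2 by ring]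
    omega

lemma fin_succ_val {n : ℕ} (i : Fin (n + 3)) :
    ((i + 1).val = i.val + 1 ∧ i.val + 1 < n + 3) ∨ ((i + 1).val = 0 ∧ i.val = n + 2) := by
  have h := i.isLt
  have h1 : (i + 1).val = (i.val + 1) % (n + 3) := by simp [Fin.val_add]
  by_cases hi : i.val + 1 < n + 3
  · left; rw [h1, Nat.mod_eq_of_lt hi]; exact ⟨rfl, hi⟩
  · right
    have : i.val = n + 2 := by omega
    rw [h1, this]; simp

lemma cycle_small (G : SimpleGraph V)
    (hsym : ∀ n : ℕ, 1 ≤ n → symbolicPower (pathIdeal3 K G) n = pathIdeal3 K G ^ n)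
    (n : ℕ) (e : G ≃g cycleGraph (n + 3)) : n = 0 ∨ n = 3 ∨ n = 6 := by
  by_cases h3 : n % 3 = 0
  · by_contra hcon
    obtain ⟨j, rfl⟩ : ∃ j, n = 9 + 3 * j := ⟨(n - 9) / 3, by omega⟩
    have := cycle_witness G hsym (9 + 3 * j) e
      (fun i => if om i.val = 0 then 5 + j else 1) (fun i => om i.val) 2 (5 + j) (by omega)
      (by
        intro i
        have h1 := fin_succ_val i
        have h2 := fin_succ_val (i + 1)
        have := i.isLt
        rcases h1 with ⟨h1, h1'⟩ | ⟨h1, h1'⟩ <;> rcases h2 with ⟨h2, h2'⟩ | ⟨h2, h2'⟩ <;>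
          rw [h2, h1]
        · exact om_window _
        · have e1 : om i.val = 1 := by
            unfold om; split_ifs <;> omega
          have e2 : om (i.val + 1) = 1 := by
            unfold om; split_ifs <;> omega
          omega
        · have e1 : om i.val = 1 := by
            unfold om; split_ifs <;> omega
          have e2 : om (0 + 1) = 1 := by decide
          omega
        · omega)
      (by
        intro c hc
        by_cases hz : ∀ i, om i.val = 0 → c i = 0
        · let c' : ℕ → ℕ := fun x => if h : x < 9 + 3 * j + 3 then c ⟨x, h⟩ else 0
          have hc' : ∀ i : Fin (9 + 3 * j + 3), c' i.val = c i := fun i => by simp [c']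
          have z0 : c' 0 = 0 := by
            have := hz ⟨0, by omega⟩ (by simp [om])
            rwa [← hc'] at this
          have key := cover_om j c' (by
            intro x hx
            by_cases hxn : x + 2 = 12 + 3 * j
            · have := hc ⟨x, by omega⟩
              have h1 := fin_succ_val (⟨x, by omega⟩ : Fin (9 + 3 * j + 3))
              have h2 := fin_succ_val ((⟨x, by omega⟩ : Fin (9 + 3 * j + 3)) + 1)
              simp only at h1 h2
              rw [← hc', ← hc', ← hc'] at this
              have e1 : ((⟨x, by omega⟩ : Fin (9 + 3 * j + 3)) + 1).val = x + 1 := by omega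
              have e2 : ((⟨x, by omega⟩ : Fin (9 + 3 * j + 3)) + 1 + 1).val = 0 := by omega
              rw [e1, e2, z0] at this
              simp only at this
              omega
            have := hc ⟨x, by omega⟩
            have h1 := fin_succ_val (⟨x, by omega⟩ : Fin (9 + 3 * j + 3))
            have h2 := fin_succ_val ((⟨x, by omega⟩ : Fin (9 + 3 * j + 3)) + 1)
            simp only at h1 h2
            rw [← hc', ← hc', ← hc'] at this
            have e1 : ((⟨x, by omega⟩ : Fin (9 + 3 * j + 3)) + 1).val = x + 1 := by omega
            have e2 : ((⟨x, by omega⟩ : Fin (9 + 3 * j + 3)) + 1 + 1).val = x + 2 := by omega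
            rwa [e1, e2] at this) (by
            intro x hx hx0
            by_cases hxn : x = 12 + 3 * j
            · simp only [c']
              rw [dif_neg (by omega)]
            have := hz ⟨x, by omega⟩ hx0
            rwa [← hc'] at this) j le_rfl
          have hlast := hc ⟨11 + 3 * j, by omega⟩
          have h1 := fin_succ_val (⟨11 + 3 * j, by omega⟩ : Fin (9 + 3 * j + 3))
          have h2 := fin_succ_val ((⟨11 + 3 * j, by omega⟩ : Fin (9 + 3 * j + 3)) + 1)
          simp only at h1 h2
          rw [← hc', ← hc', ← hc'] at hlast
          have e1 : ((⟨11 + 3 * j, by omega⟩ : Fin (9 + 3 * j + 3)) + 1).val = 0 := by omega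
          have e2 : ((⟨11 + 3 * j, by omega⟩ : Fin (9 + 3 * j + 3)) + 1 + 1).val = 1 := by omega
          rw [e1, e2] at hlast
          simp only at hlast
          have hsum : ∑ x ∈ Finset.range (12 + 3 * j), c' x * om x ≤
              ∑ i : Fin (9 + 3 * j + 3), c i * (if om i.val = 0 then 5 + j else 1) := by
            rw [show 12 + 3 * j = 9 + 3 * j + 3 by ring, Finset.sum_range]
            refine Finset.sum_le_sum fun i _ => ?_
            rw [hc']
            refine Nat.mul_le_mul_left _ ?_
            unfold om
            split_ifs <;> omega
          omega
        · push Not at hz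
          obtain ⟨i, hi, hci⟩ := hz
          refine le_trans ?_ (Finset.single_le_sum (fun _ _ => Nat.zero_le _) (Finset.mem_univ i))
          simp only [hi, if_true]
          exact Nat.le_mul_of_pos_left _ (Nat.pos_of_ne_zero hci))
    have h2 : ∑ i : Fin (9 + 3 * j + 3), om i.val * (if om i.val = 0 then 5 + j else 1)
        = ∑ i : Fin (9 + 3 * j + 3), om i.val := by
      refine Finset.sum_congr rfl fun i _ => ?_
      split_ifs with h
      · simp [h]
      · simp
    have h3 := sum_om j
    rw [show 12 + 3 * j = 9 + 3 * j + 3 by ring, Finset.sum_range] at h3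
    rw [h2, h3] at this
    omega
  · have := cycle_witness G hsym n e (fun _ => 1) (fun _ => 1) 3 ((n + 5) / 3) (by omega)
      (by intro i; norm_num) (by
        intro c hc
        have h1 := Finset.sum_le_sum fun i (_ : i ∈ Finset.univ) => hc i
        rw [Finset.sum_add_distrib, Finset.sum_add_distrib] at h1
        have h2 : ∑ i, c (i + 1) = ∑ i, c i := Equiv.sum_comp (Equiv.addRight 1) c
        have h3 : ∑ i, c (i + 1 + 1) = ∑ i, c (i + 1) :=
          Equiv.sum_comp (Equiv.addRight 1) fun i => c (i + 1)
        simp at h1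
        simp
        omega)
    simp at this
    omega

end forward

end CPI
/-- For a finite connected simple graph `G` with cubic path ideal
`J = I₃(G)`, one has `J⁽ⁿ⁾ = Jⁿ` for all `n ≥ 1` if and only if `G` is isomorphic to a path
graph `P_m` (for some `m ≥ 1`) or to the cycle `C_{3k}` for some `k ∈ {1, 2, 3}`. -/
theorem symbolicPower_eq_pow_iff_path_or_small_cycle
    (K : Type*) [Field K] {V : Type*} [Fintype V] [DecidableEq V]
    (G : SimpleGraph V) (hconn : G.Connected) :
    (∀ n : ℕ, 1 ≤ n →
        symbolicPower (pathIdeal3 K G) n = (pathIdeal3 K G) ^ n) ↔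
      ((∃ m : ℕ, 1 ≤ m ∧ Nonempty (G ≃g pathGraph m)) ∨
        (∃ k : ℕ, (k = 1 ∨ k = 2 ∨ k = 3) ∧ Nonempty (G ≃g cycleGraph (3 * k)))) := by
  constructor
  · intro hsym
    rcases CPI.classify G hconn (CPI.no_claw G hsym) with h | ⟨n, ⟨e⟩⟩
    · exact Or.inl h
    · right
      rcases CPI.cycle_small G hsym n e with rfl | rfl | rfl
      · exact ⟨1, by simp, ⟨e⟩⟩
      · exact ⟨2, by simp, ⟨e⟩⟩
      · exact ⟨3, by simp, ⟨e⟩⟩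
  · rintro (⟨m, _, ⟨e⟩⟩ | ⟨k, hk, ⟨e⟩⟩) n _
    · exact CPI.symbolic_eq_of_mfmc G (CPI.mfmc_path m G e) n
    · refine CPI.symbolic_eq_of_mfmc G (CPI.mfmc_iso G _ e ?_) n
      rcases hk with rfl | rfl | rfl
      · have := CPI.mfmc_cyc3
        rwa [← CPI.triples_cycle 0] at this
      · have := CPI.mfmc_cyc6
        rwa [← CPI.triples_cycle 3] at this
      · have := CPI.mfmc_cyc9
        rwa [← CPI.triples_cycle 6] at this
end

section
/- Let p ≥ 3 be an integer and let M be the p × p matrix over ℕ with rows and columns indexed by ℤ/pℤ defined by M_{i,j} = 1 if j ∈ {i, i−1, i−2} (mod p) and M_{i,j} = 0 otherwise (each row has 1's in three cyclically consecutive columns). For a ∈ ℕ^p let ν_a(M) = max{𝟙·y : M y ≤ a, y ∈ ℕ^p} and τ_a(M) = min{a·z : Mᵀ z ≥ 𝟙, z ∈ ℕ^p}, where 𝟙 is the all-ones vector and all inequalities are entrywise. Then ν_a(M) = τ_a(M) holds for every a ∈ ℕ^p if and only if p = 3k for some k ∈ {1, 2, 3}, i.e. p ∈ {3, 6, 9}.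 -/
namespace CircNT

open Finset

lemma row_sum (p : ℕ) [NeZero p] (hp : 3 ≤ p) (i : ZMod p) (f : ZMod p → ℕ) :
    ∑ j : ZMod p, (if j = i ∨ j = i - 1 ∨ j = i - 2 then 1 else 0) * f j
      = f i + f (i - 1) + f (i - 2) := by
  have h1 : (1 : ZMod p) ≠ 0 := by
    intro h
    have := (ZMod.natCast_eq_zero_iff 1 p).1 (by exact_mod_cast h)
    have := Nat.le_of_dvd (by norm_num) this
    omega
  have h2 : (2 : ZMod p) ≠ 0 := by
    intro h
    have := (ZMod.natCast_eq_zero_iff 2 p).1 (by exact_mod_cast h)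
    have := Nat.le_of_dvd (by norm_num) this
    omega
  have e1 : i ≠ i - 1 := by
    intro h; apply h1; linear_combination h
  have e2 : i ≠ i - 2 := by
    intro h; apply h2; linear_combination h
  have e3 : i - 1 ≠ i - 2 := by
    intro h; apply h1; linear_combination h
  have : ∀ j : ZMod p, (if j = i ∨ j = i - 1 ∨ j = i - 2 then 1 else 0) * f j
      = (if j = i then f j else 0) + (if j = i - 1 then f j else 0)
        + (if j = i - 2 then f j else 0) := by
    intro j
    by_cases a : j = i
    · subst a; simp [e1, e2]
    · by_cases b : j = i - 1
      · subst b; simp [e1.symm, e3]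
      · by_cases c : j = i - 2
        · subst c; simp [e2.symm, e3.symm]
        · simp [a, b, c]
  simp only [this, Finset.sum_add_distrib]
  simp

lemma col_sum (p : ℕ) [NeZero p] (hp : 3 ≤ p) (j : ZMod p) (f : ZMod p → ℕ) :
    ∑ i : ZMod p, (if j = i ∨ j = i - 1 ∨ j = i - 2 then 1 else 0) * f i
      = f j + f (j + 1) + f (j + 2) := by
  have := row_sum p hp (j + 2) f
  rw [show j + 2 - 1 = j + 1 by ring, show j + 2 - 2 = j by ring] at this
  rw [show f j + f (j + 1) + f (j + 2) = f (j + 2) + f (j + 1) + f j by ring, ← this]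
  refine Finset.sum_congr rfl fun i _ => ?_
  have e : (j = i ∨ j = i - 1 ∨ j = i - 2) ↔ (i = j + 2 ∨ i = j + 1 ∨ i = j) := by
    rw [eq_sub_iff_add_eq, eq_sub_iff_add_eq, eq_comm (a := j) (b := i),
      eq_comm (a := j + 1) (b := i), eq_comm (a := j + 2) (b := i)]
    tauto
  simp only [e]

def YF {p : ℕ} (a y : ZMod p → ℕ) : Prop := ∀ i, y i + y (i - 1) + y (i - 2) ≤ a i
def ZF {p : ℕ} (z : ZMod p → ℕ) : Prop := ∀ j, 1 ≤ z j + z (j + 1) + z (j + 2)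

/-- Swapping the order of summation. -/
lemma swap_sum (p : ℕ) [NeZero p] (y z : ZMod p → ℕ) :
    ∑ i, z i * (y i + y (i - 1) + y (i - 2)) = ∑ j, y j * (z j + z (j + 1) + z (j + 2)) := by
  simp only [mul_add, Finset.sum_add_distrib]
  have h1 : ∑ i, z i * y (i - 1) = ∑ j, y j * z (j + 1) := by
    rw [← Equiv.sum_comp (Equiv.addRight (1 : ZMod p))]
    simp [mul_comm]
  have h2 : ∑ i, z i * y (i - 2) = ∑ j, y j * z (j + 2) := by
    rw [← Equiv.sum_comp (Equiv.addRight (2 : ZMod p))]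
    simp [mul_comm]
  rw [h1, h2]
  simp [mul_comm]

lemma weak (p : ℕ) [NeZero p] (a y z : ZMod p → ℕ) (hy : YF a y) (hz : ZF z) :
    ∑ j, y j ≤ ∑ i, a i * z i := by
  calc ∑ j, y j ≤ ∑ j, y j * (z j + z (j + 1) + z (j + 2)) :=
        Finset.sum_le_sum fun j _ => Nat.le_mul_of_pos_right _ (hz j)
    _ = ∑ i, z i * (y i + y (i - 1) + y (i - 2)) := (swap_sum p y z).symm
    _ ≤ ∑ i, a i * z i := Finset.sum_le_sum fun i _ => by
        rw [mul_comm]; exact Nat.mul_le_mul_right _ (hy i)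

def SY {p : ℕ} [NeZero p] (a : ZMod p → ℕ) : Set ℕ := {s | ∃ y, YF a y ∧ s = ∑ j, y j}
def SZ {p : ℕ} [NeZero p] (a : ZMod p → ℕ) : Set ℕ := {s | ∃ z, ZF z ∧ s = ∑ i, a i * z i}

lemma SZ_ne {p : ℕ} [NeZero p] (a : ZMod p → ℕ) : (SZ a).Nonempty :=
  ⟨_, fun _ => 1, fun _ => by norm_num, rfl⟩

lemma SY_ne {p : ℕ} [NeZero p] (a : ZMod p → ℕ) : (SY a).Nonempty :=
  ⟨_, fun _ => 0, fun _ => by simp, rfl⟩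

lemma SY_bdd {p : ℕ} [NeZero p] (a : ZMod p → ℕ) : BddAbove (SY a) := by
  obtain ⟨_, z, hz, rfl⟩ := SZ_ne a
  refine ⟨∑ i, a i * z i, ?_⟩
  rintro _ ⟨y, hy, rfl⟩
  exact weak p a y z hy hz

lemma gap {p : ℕ} [NeZero p] (a : ZMod p → ℕ) (d K : ℕ)
    (hy : ∀ y, YF a y → d * ∑ j, y j ≤ K) (hz : ∀ z, ZF z → K ≤ d * ∑ i, a i * z i)
    (hK : ¬ d ∣ K) : sSup (SY a) ≠ sInf (SZ a) := by
  intro h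
  obtain ⟨y, hy1, hy2⟩ := Nat.sSup_mem (SY_ne a) (SY_bdd a)
  obtain ⟨z, hz1, hz2⟩ := Nat.sInf_mem (SZ_ne a)
  have h1 := hy y hy1
  have h2 := hz z hz1
  rw [← hy2, h] at h1
  rw [← hz2] at h2
  exact hK ⟨_, le_antisymm h2 h1⟩

lemma sum_shift (p : ℕ) [NeZero p] (c : ZMod p) (f : ZMod p → ℕ) :
    ∑ i, f (i + c) = ∑ i, f i :=
  Equiv.sum_comp (Equiv.addRight c) f

lemma gap_not3 {p : ℕ} [NeZero p] (h : ¬ 3 ∣ p) :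
    sSup (SY (fun _ : ZMod p => 1)) ≠ sInf (SZ (fun _ : ZMod p => 1)) := by
  refine gap _ 3 p ?_ ?_ h
  · intro y hy
    have := Finset.sum_le_sum (s := Finset.univ) fun i _ => hy i
    have e := swap_sum p y (fun _ => 1)
    simp only [one_mul] at e
    rw [e, ← Finset.sum_mul] at this
    simp [ZMod.card] at this
    omega
  · intro z hz
    have := Finset.sum_le_sum (s := Finset.univ) fun i _ => hz i
    simp only [Finset.sum_add_distrib, sum_shift p _ z] at this
    simp [ZMod.card] at this
    simp
    omega

lemma gap_s {p : ℕ} [NeZero p] (s : ZMod p → ℕ) (hs : ∀ i, s i ≤ 1)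
    (h2 : ∀ j, 2 ≤ s j + s (j + 1) + s (j + 2))
    (h3 : ∀ j, s j + s (j + 1) + s (j + 2) + s (j + 3) ≤ 3)
    (hK : ¬ 2 ∣ ∑ i, s i) :
    sSup (SY (fun i => 2 - s i)) ≠ sInf (SZ (fun i => 2 - s i)) := by
  refine gap _ 2 (∑ i, s i) ?_ ?_ hK
  · intro y hy
    calc 2 * ∑ j, y j = ∑ j, y j * 2 := by rw [mul_comm, Finset.sum_mul]
      _ ≤ ∑ j, y j * (s j + s (j + 1) + s (j + 2)) :=
          Finset.sum_le_sum fun j _ => Nat.mul_le_mul_left _ (h2 j)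
      _ = ∑ i, s i * (y i + y (i - 1) + y (i - 2)) := (swap_sum p y s).symm
      _ ≤ ∑ i, s i := Finset.sum_le_sum fun i _ => by
          have := hy i
          have := hs i
          rcases (show s i = 0 ∨ s i = 1 by omega) with h | h <;> simp [h] at * <;> omega
  · intro z hz
    calc ∑ i, s i = ∑ i, s (i - 1) := by
          simpa [sub_eq_add_neg] using (sum_shift p (-1) s).symm
      _ ≤ ∑ j, s (j - 1) * (z j + z (j + 1) + z (j + 2)) :=
          Finset.sum_le_sum fun j _ => Nat.le_mul_of_pos_right _ (hz j)
      _ = ∑ i, z i * (s (i - 1) + s (i - 1 - 1) + s (i - 2 - 1)) :=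
          (swap_sum p (fun j => s (j - 1)) z).symm
      _ ≤ ∑ i, z i * (2 * (2 - s i)) := Finset.sum_le_sum fun i _ => by
          refine Nat.mul_le_mul_left _ ?_
          have := h3 (i - 3)
          rw [show i - 3 + 1 = i - 1 - 1 by ring, show i - 3 + 2 = i - 1 by ring,
            show i - 3 + 3 = i by ring, show i - 3 = i - 2 - 1 by ring] at this
          have := hs i
          have := hs (i - 1)
          have := hs (i - 1 - 1)
          have := hs (i - 2 - 1)
          omega
      _ = 2 * ∑ i, (2 - s i) * z i := by
          rw [Finset.mul_sum]
          exact Finset.sum_congr rfl fun i _ => by ring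

def sn (v : ℕ) : ℕ := if v = 0 ∨ v = 4 ∨ v = 8 ∨ (12 ≤ v ∧ v % 3 = 0) then 0 else 1

lemma sn_zero (v : ℕ) (h : 12 ≤ v) (h' : v % 3 = 0) : sn v = 0 := by
  unfold sn
  rw [if_pos]
  exact Or.inr (Or.inr (Or.inr ⟨h, h'⟩))

lemma sn_one (v : ℕ) (h : 12 ≤ v) (h' : v % 3 ≠ 0) : sn v = 1 := by
  unfold sn
  rw [if_neg]
  rintro (h | h | h | h)
  · omega
  · omega
  · omega
  · exact h' h.2

lemma sum_sn (k : ℕ) : ∑ i ∈ Finset.range (12 + 3 * k), sn i = 9 + 2 * k := by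
  induction k with
  | zero => decide
  | succ k ih =>
    rw [show 12 + 3 * (k + 1) = 12 + 3 * k + 1 + 1 + 1 by ring, Finset.sum_range_succ,
      Finset.sum_range_succ, Finset.sum_range_succ, ih]
    rw [sn_zero (12 + 3 * k) (by omega) (by omega),
      sn_one (12 + 3 * k + 1) (by omega) (by omega),
      sn_one (12 + 3 * k + 1 + 1) (by omega) (by omega)]
    ring

lemma sum_val (p : ℕ) [NeZero p] (f : ℕ → ℤ) :
    ∑ i : ZMod p, f i.val = ∑ i ∈ Finset.range p, f i := by
  obtain ⟨q, rfl⟩ : ∃ q, p = q + 1 := ⟨p - 1, by have := NeZero.pos p; omega⟩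
  exact Fin.sum_univ_eq_sum_range f (q + 1)

lemma val_shift (p : ℕ) [NeZero p] (i : ZMod p) (e : ℕ) (he : e ≤ p) :
    (i + e).val = if i.val + e < p then i.val + e else i.val + e - p := by
  have hv := ZMod.val_lt i
  rw [ZMod.val_add, ZMod.val_natCast, Nat.add_mod_mod]
  split_ifs with h
  · exact Nat.mod_eq_of_lt h
  · rw [Nat.mod_eq_sub_mod (by omega), Nat.mod_eq_of_lt (by omega)]

lemma gap_3 (k : ℕ) [NeZero (12 + 3 * k)] :
    ∃ a : ZMod (12 + 3 * k) → ℕ, sSup (SY a) ≠ sInf (SZ a) := by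
  have q1 : ∀ j : ZMod (12 + 3 * k), (j + 1).val = _ := fun j => by
    simpa using val_shift _ j 1 (by omega)
  have q2 : ∀ j : ZMod (12 + 3 * k), (j + 2).val = _ := fun j => by
    simpa using val_shift _ j 2 (by omega)
  have q3 : ∀ j : ZMod (12 + 3 * k), (j + 3).val = _ := fun j => by
    simpa using val_shift _ j 3 (by omega)
  refine ⟨_, gap_s (fun i => sn i.val) ?_ ?_ ?_ ?_⟩
  · intro i; simp only [sn]; split_ifs <;> omega
  · intro j
    simp only [q1, q2]
    have := ZMod.val_lt j
    generalize j.val = v at *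
    unfold sn
    grind
  · intro j
    simp only [q1, q2, q3]
    have := ZMod.val_lt j
    generalize j.val = v at *
    unfold sn
    grind
  · have h := sum_val (12 + 3 * k) (fun v => (sn v : ℤ))
    have h' := sum_sn k
    have : ∑ i : ZMod (12 + 3 * k), sn i.val = 9 + 2 * k := by
      rw [← h']; exact_mod_cast h
    rw [this]; omega

/-! ### The positive direction -/

def disp : List Bool → ℤ
  | [] => 0
  | true :: l => 3 + disp l
  | false :: l => -1 + disp l

def cost {p : ℕ} (a : ZMod p → ℕ) : ℤ → List Bool → ℕ
  | _, [] => 0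
  | u, true :: l => a ((u + 3 : ℤ) : ZMod p) + cost a (u + 3) l
  | u, false :: l => cost a (u - 1) l

def zf (p : ℕ) : ℤ → List Bool → ZMod p → ℕ
  | _, [] => 0
  | u, true :: l => Pi.single ((u + 3 : ℤ) : ZMod p) 1 + zf p (u + 3) l
  | u, false :: l => zf p (u - 1) l

lemma disp_append (l m : List Bool) : disp (l ++ m) = disp l + disp m := by
  induction l with
  | nil => simp [disp]
  | cons b l ih => cases b <;> simp [disp, ih] <;> ring

lemma cost_append {p : ℕ} (a : ZMod p → ℕ) (l m : List Bool) (u : ℤ) :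
    cost a u (l ++ m) = cost a u l + cost a (u + disp l) m := by
  induction l generalizing u with
  | nil => simp [disp, cost]
  | cons b l ih =>
    cases b
    · simp only [List.cons_append, cost, disp, ih]
      rw [show u - 1 + disp l = u + (-1 + disp l) by ring]
    · simp only [List.cons_append, cost, disp, ih]
      rw [show u + 3 + disp l = u + (3 + disp l) by ring, add_assoc]

lemma cost_shift {p : ℕ} (a : ZMod p → ℕ) (l : List Bool) (u m : ℤ) :
    cost a (u + p * m) l = cost a u l := by
  induction l generalizing u with
  | nil => rfl
  | cons b l ih =>
    cases b
    · simp only [cost]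
      rw [← ih (u - 1), show u - 1 + p * m = u + p * m - 1 by ring]
    · simp only [cost]
      rw [← ih (u + 3), show u + 3 + p * m = u + p * m + 3 by ring]
      simp

lemma cost_zf {p : ℕ} [NeZero p] (a : ZMod p → ℕ) (l : List Bool) (u : ℤ) :
    ∑ i, a i * zf p u l i = cost a u l := by
  induction l generalizing u with
  | nil => simp [zf, cost]
  | cons b l ih =>
    cases b
    · simp only [cost, zf, ih]
    · simp only [cost, zf, Pi.add_apply, mul_add, Finset.sum_add_distrib, ih]
      simp [Pi.single_apply]

lemma zf_cover {p : ℕ} (l : List Bool) (u j : ℤ) (h1 : u < j) (h2 : j ≤ u + disp l) :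
    1 ≤ zf p u l (j : ZMod p) + zf p u l ((j : ZMod p) + 1) + zf p u l ((j : ZMod p) + 2) := by
  induction l generalizing u with
  | nil => simp [disp] at h2; omega
  | cons b l ih =>
    cases b
    · simp only [disp] at h2
      exact ih (u - 1) (by omega) (by omega)
    · simp only [disp] at h2
      simp only [zf, Pi.add_apply]
      by_cases h : j ≤ u + 3
      · rcases (show u + 3 = j ∨ u + 3 = j + 1 ∨ u + 3 = j + 2 by omega) with e | e | e
        · rw [e]; simp; omega
        · rw [e]; push_cast; simp; omega
        · rw [e]; push_cast; simp; omega
      · have := ih (u + 3) (by omega) (by omega)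
        omega

lemma cost_one {p : ℕ} [NeZero p] (a : ZMod p → ℕ) (N : ℕ)
    (hN : ∀ z, ZF z → N ≤ ∑ i, a i * z i) (l : List Bool) (u : ℤ) (h : (p : ℤ) ≤ disp l) :
    N ≤ cost a u l := by
  rw [← cost_zf]
  apply hN
  intro j
  have hv := ZMod.val_lt (j - ((u + 1 : ℤ) : ZMod p))
  have := zf_cover (p := p) l u (u + 1 + ((j - ((u + 1 : ℤ) : ZMod p)).val : ℤ)) (by omega)
    (by omega)
  have e : ((u + 1 + ((j - ((u + 1 : ℤ) : ZMod p)).val : ℤ) : ℤ) : ZMod p) = j := by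
    push_cast
    rw [ZMod.natCast_zmod_val]
    ring
  rw [e] at this
  exact this

/-- Long walks contain a proper closed subwalk. -/
lemma pigeon (p : ℕ) [NeZero p] (l : List Bool) (h : p < l.length) :
    ∃ l1 l2 l3 : List Bool, l = l1 ++ l2 ++ l3 ∧ 0 < l2.length ∧ l2.length < l.length ∧
      ∃ w : ℤ, disp l2 = p * w := by
  obtain ⟨x, y, hxy, he⟩ := Fintype.exists_ne_map_eq_of_card_lt
    (fun k : Fin (p + 1) => ((disp (l.take k) : ℤ) : ZMod p)) (by simp [ZMod.card])
  wlog hlt : x < y generalizing x y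
  · exact this y x hxy.symm he.symm (lt_of_le_of_ne (not_lt.1 hlt) hxy.symm)
  have hlt' : (x : ℕ) < y := hlt
  have hy := y.2
  have hs : l.take y = l.take x ++ (l.take y).drop x := by
    conv_lhs => rw [← List.take_append_drop x (l.take y)]
    rw [List.take_take, min_eq_left hlt'.le]
  refine ⟨l.take x, (l.take y).drop x, l.drop y, ?_, ?_, ?_, ?_⟩
  · rw [← hs, List.take_append_drop]
  · simp; omega
  · simp; omega
  · have := congrArg disp hs
    rw [disp_append] at this
    have h2 := (ZMod.intCast_eq_intCast_iff_dvd_sub _ _ _).1 he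
    rw [this] at h2
    have h3 : (p : ℤ) ∣ disp ((l.take y).drop x) := by simpa using h2
    exact h3

/-- The property of `p` used: short walks with displacement at least `2p` have a proper
closed subwalk. -/
def Good (p : ℕ) : Prop := ∀ l : List Bool, l.length ≤ p → 2 * (p : ℤ) ≤ disp l →
  ∃ l1 l2 l3 : List Bool, l = l1 ++ l2 ++ l3 ∧ 0 < l2.length ∧ l2.length < l.length ∧
      ∃ w : ℤ, disp l2 = p * w

lemma cost_key {p : ℕ} [NeZero p] (hG : Good p) (a : ZMod p → ℕ) (N : ℕ)
    (hN : ∀ z, ZF z → N ≤ ∑ i, a i * z i) :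
    ∀ n : ℕ, ∀ l : List Bool, l.length = n → ∀ u w : ℤ, p * w ≤ disp l →
      N * w ≤ cost a u l := by
  intro n
  induction n using Nat.strong_induction_on with
  | _ n ih =>
  intro l hl u w hw
  have hp0 : (0 : ℤ) < p := by exact_mod_cast NeZero.pos p
  by_cases hw0 : w ≤ 0
  · have : (N : ℤ) * w ≤ 0 := mul_nonpos_of_nonneg_of_nonpos (by positivity) hw0
    have : (0 : ℤ) ≤ cost a u l := by positivity
    omega
  by_cases hw1 : w = 1
  · subst hw1
    have := cost_one a N hN l u (by simpa using hw)
    simpa using this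
  have hx : ∃ l1 l2 l3 : List Bool, l = l1 ++ l2 ++ l3 ∧ 0 < l2.length ∧ l2.length < l.length ∧
      ∃ w : ℤ, disp l2 = p * w := by
    by_cases hlp : l.length ≤ p
    · exact hG l hlp (by nlinarith [show 2 ≤ w by omega])
    · exact pigeon p l (by omega)
  obtain ⟨l1, l2, l3, e, h0, h1, w', hw'⟩ := hx
  have c : cost a u l = cost a (u + disp l1) l2 + cost a u (l1 ++ l3) := by
    rw [e, cost_append, cost_append, cost_append, disp_append, hw', ← add_assoc, cost_shift]
    ring
  have d : disp l = disp l2 + disp (l1 ++ l3) := by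
    rw [e, disp_append, disp_append, disp_append]; ring
  have i1 := ih l2.length (by omega) l2 rfl (u + disp l1) w' hw'.ge
  have i2 := ih (l1 ++ l3).length (by rw [← hl, e]; simp; omega) (l1 ++ l3) rfl u (w - w')
    (by rw [mul_sub]; omega)
  rw [c]
  push_cast
  rw [mul_sub] at i2
  linarith

lemma good3 : Good 3 := by
  intro l h1 h2
  have : ∃ l1 l3 : List Bool, l = l1 ++ [true] ++ l3 := by
    rcases l with _ | ⟨x, l⟩
    · simp [disp] at h2
    · rcases x with _ | _
      · rcases l with _ | ⟨y, l⟩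
        · simp [disp] at h2
        · rcases y with _ | _
          · rcases l with _ | ⟨y, l⟩
            · simp [disp] at h2
            · rcases l with _ | ⟨_, _⟩
              · cases y <;> simp [disp] at h2
              · simp at h1; omega
          · exact ⟨[false], l, rfl⟩
      · exact ⟨[], l, rfl⟩
  obtain ⟨l1, l3, e⟩ := this
  refine ⟨l1, [true], l3, e, by simp, ?_, 1, by simp [disp]⟩
  rcases l with _ | ⟨x, _ | ⟨y, l⟩⟩
  · simp [disp] at h2
  · cases x <;> simp [disp] at h2
  · simp

lemma two_true (n : ℕ) : ∀ l : List Bool, l.length ≤ 2 * n → 2 * (n : ℤ) + 2 ≤ disp l →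
    ∃ l1 l3 : List Bool, l = l1 ++ [true, true] ++ l3 := by
  induction n with
  | zero =>
    intro l h1 h2
    have : l = [] := List.length_eq_zero_iff.1 (by omega)
    subst this
    simp [disp] at h2
  | succ n ih =>
    intro l h1 h2
    push_cast at h2
    rcases l with _ | ⟨x, _ | ⟨y, l⟩⟩
    · simp [disp] at h2; omega
    · cases x <;> simp [disp] at h2 <;> omega
    · by_cases hxy : x = true ∧ y = true
      · obtain ⟨rfl, rfl⟩ := hxy
        exact ⟨[], l, rfl⟩
      · simp at h1
        obtain ⟨l1, l3, e⟩ := ih l (by omega) (by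
          cases x <;> cases y <;> simp [disp] at h2 hxy <;> omega)
        exact ⟨x :: y :: l1, l3, by rw [e]; simp⟩

lemma three_true (n : ℕ) : ∀ l : List Bool, l.length ≤ 3 * n → 5 * (n : ℤ) + 2 ≤ disp l →
    ∃ l1 l3 : List Bool, l = l1 ++ [true, true, true] ++ l3 := by
  induction n with
  | zero =>
    intro l h1 h2
    have : l = [] := List.length_eq_zero_iff.1 (by omega)
    subst this
    simp [disp] at h2
  | succ n ih =>
    intro l h1 h2
    push_cast at h2
    rcases l with _ | ⟨x, _ | ⟨y, _ | ⟨z, l⟩⟩⟩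
    · simp [disp] at h2; omega
    · cases x <;> simp [disp] at h2 <;> omega
    · cases x <;> cases y <;> simp [disp] at h2 <;> omega
    · by_cases hxy : x = true ∧ y = true ∧ z = true
      · obtain ⟨rfl, rfl, rfl⟩ := hxy
        exact ⟨[], l, rfl⟩
      · simp at h1
        obtain ⟨l1, l3, e⟩ := ih l (by omega) (by
          cases x <;> cases y <;> cases z <;> simp [disp] at h2 hxy <;> omega)
        exact ⟨x :: y :: z :: l1, l3, by rw [e]; simp⟩

lemma disp_le (l : List Bool) : disp l ≤ 3 * l.length := by
  induction l with
  | nil => simp [disp]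
  | cons b l ih => cases b <;> simp [disp] <;> omega

lemma good6 : Good 6 := by
  intro l h1 h2
  have := disp_le l
  push_cast at h2
  obtain ⟨l1, l3, e⟩ := two_true 3 l (by omega) (by push_cast; omega)
  exact ⟨l1, _, l3, e, by simp, by simp; omega, 1, by simp [disp]⟩

lemma good9 : Good 9 := by
  intro l h1 h2
  have := disp_le l
  push_cast at h2
  obtain ⟨l1, l3, e⟩ := three_true 3 l (by omega) (by push_cast; omega)
  exact ⟨l1, _, l3, e, by simp, by simp; omega, 1, by simp [disp]⟩

/-- Costs of walks from the multiples of `p` to `v`. -/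
def XS {p : ℕ} (a : ZMod p → ℕ) (N : ℕ) (v : ℤ) : Set ℤ :=
  {c | ∃ (m : ℤ) (l : List Bool), p * m + disp l = v ∧ c = N * m + cost a (p * m) l}

lemma disp_rep (n : ℕ) : disp (List.replicate n false) = -n := by
  induction n with
  | zero => rfl
  | succ n ih => simp [List.replicate_succ, disp, ih]

lemma exists_y {p : ℕ} [NeZero p] (hG : Good p) (a : ZMod p → ℕ) (N : ℕ)
    (hN : ∀ z, ZF z → N ≤ ∑ i, a i * z i) : ∃ y, YF a y ∧ N = ∑ j, y j := by
  have hp0 : (0 : ℤ) < p := by exact_mod_cast NeZero.pos p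
  have hne : ∀ v, (XS a N v).Nonempty := by
    intro v
    refine ⟨_, |v|, List.replicate (p * |v| - v).toNat false, ?_, rfl⟩
    rw [disp_rep, Int.toNat_of_nonneg]
    · ring
    · nlinarith [le_abs_self v, abs_nonneg v]
  have hbd : ∀ v, BddBelow (XS a N v) := by
    intro v
    refine ⟨N * (v / p), ?_⟩
    rintro _ ⟨m, l, h1, rfl⟩
    have := cost_key hG a N hN _ l rfl (p * m) (v / p - m) (by
      have := Int.mul_ediv_self_le (x := v) (k := p) hp0.ne'
      rw [mul_sub]; omega)
    rw [mul_sub] at this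
    omega
  set X : ℤ → ℤ := fun v => sInf (XS a N v) with hX
  have hmem : ∀ v, X v ∈ XS a N v := fun v => Int.csInf_mem (hne v) (hbd v)
  have hle : ∀ v c, c ∈ XS a N v → X v ≤ c := fun v c h => csInf_le (hbd v) h
  have X1 : ∀ v, X (v - 1) ≤ X v := by
    intro v
    obtain ⟨m, l, h1, h2⟩ := hmem v
    refine hle _ _ ⟨m, l ++ [false], ?_, ?_⟩
    · rw [disp_append]; simp [disp]; omega
    · rw [h2, cost_append]; simp [cost]
  have X3 : ∀ v, X v ≤ X (v - 3) + a (v : ZMod p) := by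
    intro v
    obtain ⟨m, l, h1, h2⟩ := hmem (v - 3)
    refine hle _ _ ⟨m, l ++ [true], ?_, ?_⟩
    · rw [disp_append]; simp [disp]; omega
    · rw [h2, cost_append, h1]; simp [cost]; ring
  have Xp' : ∀ v e, X (v + p * e) ≤ X v + N * e := by
    intro v e
    obtain ⟨m, l, h1, h2⟩ := hmem v
    refine hle _ _ ⟨m + e, l, ?_, ?_⟩
    · rw [mul_add]; omega
    · rw [h2, mul_add, mul_add, cost_shift]; ring
  have Xp : ∀ v e, X (v + p * e) = X v + N * e := by
    intro v e
    refine le_antisymm (Xp' v e) ?_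
    have := Xp' (v + p * e) (-e)
    rw [show v + p * e + p * -e = v by ring] at this
    linarith
  set y : ZMod p → ℕ := fun j => (X j.val - X (j.val - 1)).toNat with hy
  have yv : ∀ v : ℤ, (y (v : ZMod p) : ℤ) = X v - X (v - 1) := by
    intro v
    simp only [hy]
    rw [Int.toNat_of_nonneg (by linarith [X1 ((v : ZMod p).val)]), ZMod.val_intCast]
    have h := Int.emod_add_mul_ediv v p
    have e1 := Xp (v % p) (v / p)
    have e2 := Xp (v % p - 1) (v / p)
    rw [h] at e1
    rw [show v % p - 1 + p * (v / p) = v - 1 by linarith] at e2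
    linarith
  refine ⟨y, ?_, ?_⟩
  · intro i
    obtain ⟨v, rfl⟩ := ZMod.intCast_surjective i
    have e0 := yv v
    have e1 := yv (v - 1)
    have e2 := yv (v - 2)
    have := X3 v
    push_cast at e1 e2
    rw [show v - 1 - 1 = v - 2 by ring] at e1
    rw [show v - 2 - 1 = v - 3 by ring] at e2
    zify
    linarith
  · zify
    have : ∀ j : ZMod p, (y j : ℤ) = (fun n : ℕ => X n - X (n - 1)) j.val := by
      intro j
      have := yv j.val
      simpa using this
    rw [Finset.sum_congr rfl fun j _ => this j, sum_val p (fun n : ℕ => X n - X (n - 1))]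
    have tel : ∀ n : ℕ, ∑ i ∈ Finset.range n, (X (i : ℤ) - X ((i : ℤ) - 1))
        = X ((n : ℤ) - 1) - X (-1) := by
      intro n
      induction n with
      | zero => simp
      | succ n ih => rw [Finset.sum_range_succ, ih]; push_cast; simp
    rw [tel]
    have := Xp (-1) 1
    rw [show (-1 : ℤ) + p * 1 = p - 1 by ring] at this
    rw [this]; ring

lemma good_eq {p : ℕ} [NeZero p] (hG : Good p) (a : ZMod p → ℕ) :
    sSup (SY a) = sInf (SZ a) := by
  obtain ⟨z, hz1, hz2⟩ := Nat.sInf_mem (SZ_ne a)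
  have hm : sInf (SZ a) ∈ SY a :=
    exists_y hG a _ fun z hz => Nat.sInf_le ⟨z, hz, rfl⟩
  refine IsGreatest.csSup_eq ⟨hm, ?_⟩
  rintro _ ⟨y, hy, rfl⟩
  rw [hz2]
  exact weak p a y z hy hz1

end CircNT


/-- Let `p ≥ 3` and let `M` be the `p × p` matrix over `ℕ` with rows and
columns indexed by `ℤ/pℤ`, where `M i j = 1` if `j ∈ {i, i-1, i-2} (mod p)` and `M i j = 0`
otherwise. For `a ∈ ℕᵖ` let `ν_a(M) = max{𝟙·y : M y ≤ a, y ∈ ℕᵖ}` and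
`τ_a(M) = min{a·z : Mᵀ z ≥ 𝟙, z ∈ ℕᵖ}`. Then `ν_a(M) = τ_a(M)` for every `a ∈ ℕᵖ` if and
only if `p ∈ {3, 6, 9}`. -/
theorem nu_eq_tau_iff (p : ℕ) [NeZero p] (hp : 3 ≤ p)
    (M : Matrix (ZMod p) (ZMod p) ℕ)
    (hM : ∀ i j : ZMod p, M i j = if j = i ∨ j = i - 1 ∨ j = i - 2 then 1 else 0) :
    (∀ a : ZMod p → ℕ,
      sSup {s : ℕ | ∃ y : ZMod p → ℕ,
          (∀ i : ZMod p, ∑ j : ZMod p, M i j * y j ≤ a i) ∧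
          s = ∑ j : ZMod p, y j} =
      sInf {s : ℕ | ∃ z : ZMod p → ℕ,
          (∀ j : ZMod p, 1 ≤ ∑ i : ZMod p, M i j * z i) ∧
          s = ∑ i : ZMod p, a i * z i}) ↔
    (p = 3 ∨ p = 6 ∨ p = 9) := by
  have hY : ∀ a : ZMod p → ℕ, {s : ℕ | ∃ y : ZMod p → ℕ,
          (∀ i : ZMod p, ∑ j : ZMod p, M i j * y j ≤ a i) ∧
          s = ∑ j : ZMod p, y j} = CircNT.SY a := by
    intro a
    simp only [hM, CircNT.row_sum p hp]
    rfl
  have hZ : ∀ a : ZMod p → ℕ, {s : ℕ | ∃ z : ZMod p → ℕ,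
          (∀ j : ZMod p, 1 ≤ ∑ i : ZMod p, M i j * z i) ∧
          s = ∑ i : ZMod p, a i * z i} = CircNT.SZ a := by
    intro a
    simp only [hM, CircNT.col_sum p hp]
    rfl
  simp only [hY, hZ]
  constructor
  · intro h
    by_contra hne
    by_cases h3 : 3 ∣ p
    · obtain ⟨k, rfl⟩ : ∃ k, p = 12 + 3 * k := ⟨(p - 12) / 3, by omega⟩
      obtain ⟨a, ha⟩ := CircNT.gap_3 k
      exact ha (h a)
    · exact CircNT.gap_not3 h3 (h _)
  · rintro (rfl | rfl | rfl) a
    · exact CircNT.good_eq CircNT.good3 a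
    · exact CircNT.good_eq CircNT.good6 a
    · exact CircNT.good_eq CircNT.good9 a
end
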